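/- (1) For every p ≥ 0, ι_1⁻¹(p) = 1 + #{a ∈ Q : 2^a ≤ p} + Σ_{(a,b) ∈ R, 2^b < p} ⌊(p + 2^b − 2^a)/2^{b+1}⌋. (2) The limit ν_1 := lim_{x→∞} x/ι_1(x) exists and ν_1 = Σ_{(a,b) ∈ R} 2^{−(b+1)}. (3) For every integer n ≥ 4, writing t := t^(2)(n) − 1, one has ι_1⁻¹(2^t) − 1 = ⌈ν_1·2^t⌉. -/

import Mathlib

open List Filter

open scoped Classical

noncomputable section

/-- The curling number of a finite string: the largest `k` such that
`S = X ++ Y^k` with `Y` nonempty; by convention `curl [] = 1`. -/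
def curl (S : List ℕ) : ℕ :=
  max 1 (sSup {k | ∃ X Y : List ℕ, Y ≠ [] ∧ S = X ++ (List.replicate k Y).flatten})

/-- The prefix of length `n` of the level-`m` Gijswijt sequence `A^(m)`. -/
def gPrefix (m : ℕ) : ℕ → List ℕ
  | 0 => []
  | n + 1 => gPrefix m n ++ [max m (curl (gPrefix m n))]

/-- `gij m p` is the `p`-th term (1-indexed) of the level-`m` Gijswijt sequence `A^(m)`. -/
def gij (m p : ℕ) : ℕ := max m (curl (gPrefix m (p - 1)))

/-- Standing hypothesis: for every `m ≥ 1`, the sets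
`{k ≥ 0 : C(A^(m)[1,k]) ≤ m}` and `{k ≥ 0 : C(A^(m+1)[1,k]) ≤ m}` are infinite. -/
def StandingHyp : Prop :=
  ∀ m : ℕ, 1 ≤ m →
    {k : ℕ | curl (gPrefix m k) ≤ m}.Infinite ∧
    {k : ℕ | curl (gPrefix (m + 1) k) ≤ m}.Infinite

/-- Length of `π^(m)(1,x)`: the `x`-th smallest (0-indexed) element of
`{k : C(A^(m)[1,k]) ≤ m}`. -/
def piLen (m x : ℕ) : ℕ := Nat.nth (fun k => curl (gPrefix m k) ≤ m) x

/-- `π^(m)(1,x)`: the prefix of `A^(m)` with exactly `x` occurrences of `m`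
and curling number at most `m`. -/
def piStr (m x : ℕ) : List ℕ := gPrefix m (piLen m x)

/-- `β^(m)(t)`, the length of `B_t^(m)`. -/
def beta (m t : ℕ) : ℕ := piLen m ((m + 1) ^ (t - 1))

/-- `B_t^(m) := π^(m)(1,(m+1)^(t-1))`. -/
def Bstr (m t : ℕ) : List ℕ := piStr m ((m + 1) ^ (t - 1))

/-- `τ^(m)(t)`, the length of `T_t^(m)`. -/
def tau (m t : ℕ) : ℕ := Nat.nth (fun k => curl (gPrefix (m + 1) k) ≤ m) (t - 1)

/-- `T_t^(m)`: the `t`-th shortest prefix of `A^(m+1)` with curling number at most `m`. -/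
def Tstr (m t : ℕ) : List ℕ := gPrefix (m + 1) (tau m t)

/-- `φ^(m)(n)`: the least `p ≥ 1` with `A^(m)(p) = n`. -/
def phi (m n : ℕ) : ℕ := sInf {p : ℕ | 1 ≤ p ∧ gij m p = n}

/-- `t^(m)(n) = 1 + log_{m+1} #\{i ≤ φ^(m)(n) : A^(m)(i) = m\}`. -/
def tfun (m n : ℕ) : ℕ := 1 + Nat.log (m + 1) ((gPrefix m (phi m n)).count m)

/-- `χ^(b)(a)`: read the base-`b` digits of `a` as base-`(b+1)` digits. -/
def chi (b a : ℕ) : ℕ := Nat.ofDigits (b + 1) (Nat.digits b a)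

/-- `ι_m(t)`: read the base-`(m+2)` digits of the number of occurrences of `m+1`
in `T_t^(m)` as base-`(m+1)` digits. -/
def iota (m t : ℕ) : ℕ :=
  Nat.ofDigits (m + 1) (Nat.digits (m + 2) ((Tstr m t).count (m + 1)))

/-- `ι_m⁻¹(p)`: the largest `x ≥ 1` with `ι_m(x) ≤ p`. -/
def iotaInv (m p : ℕ) : ℕ := sSup {x : ℕ | 1 ≤ x ∧ iota m x ≤ p}

/-- `ord_b(n)`: the `b`-adic valuation of `n`. -/
def ordb (b n : ℕ) : ℕ := sSup {z : ℕ | b ^ z ∣ n}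

/-- The largest base-`b` digit of `n`. -/
def maxdigit (b n : ℕ) : ℕ := (Nat.digits b n).foldr max 0

/-- Auxiliary function for the level-`m` expansion: `lexpAux m a k = a_{m+1+k}`. -/
def lexpAux (m a : ℕ) : ℕ → ℕ
  | 0 => a
  | k + 1 => iota (m + 1 + k) (ordb (m + 1 + k) (lexpAux m a k) + 1)

/-- `lexp m a l = a_l`, the `l`-th term of the level-`m` expansion of `a`. -/
def lexp (m a l : ℕ) : ℕ := lexpAux m a (l - (m + 1))

/-- The last element `n` of `π^(m+1)(1, χ^(m+1)(a))`; the level-`m` expansion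
of `a` is `a_{m+1}, …, a_n`. -/
def levelEnd (m a : ℕ) : ℕ := (piStr (m + 1) (chi (m + 1) a)).getLastD 0

/-- `V_m := {v ≥ 0 : C(T_{v+1}^(m+1)) ≤ m}`. -/
def Vset (m : ℕ) : Set ℕ := {v | curl (Tstr (m + 1) (v + 1)) ≤ m}

/-- `Q := {α ≥ 0 : C(T_{α+1}^(2)) = 1}`. -/
def Qset : Set ℕ := {a | curl (Tstr 2 (a + 1)) = 1}

/-- `R := {(a,b) : a ∈ Q, a < b, no suffix S of T_{a+1}^(2) with T_{a+1}^(2)·S = T_{b+1}^(2)}`. -/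
def Rset : Set (ℕ × ℕ) :=
  {p | p.1 ∈ Qset ∧ p.1 < p.2 ∧
    ¬∃ S : List ℕ, S <:+ Tstr 2 (p.1 + 1) ∧ Tstr 2 (p.1 + 1) ++ S = Tstr 2 (p.2 + 1)}

/-- The digit of `x` in base `b` at (1-indexed) position `i`, i.e. the coefficient
of `b^(i-1)`. -/
def digitAt (b x i : ℕ) : ℕ := (Nat.digits b x).getD (i - 1) 0

/-- `u` is the (1-indexed) position of the second nonzero base-`b` digit of `x`
(the first nonzero digit being at position `ord_b(x)+1`). -/
def IsSecondNonzero (b x u : ℕ) : Prop :=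
  ordb b x + 1 < u ∧ digitAt b x u ≠ 0 ∧
    ∀ i, ordb b x + 1 < i → i < u → digitAt b x i = 0

/-- `𝒮_b`: pairs `(a,a')` with `1 ≤ a < a'` such that for some position `y` the
base-`b` digits of `a` and `a'` agree away from `y` and twice the `y`-th digit of `a`
is at least the `y`-th digit of `a'`. -/
def Sset (b : ℕ) : Set (ℕ × ℕ) :=
  {p | 1 ≤ p.1 ∧ p.1 < p.2 ∧
    ∃ y : ℕ, (∀ i, i ≠ y → (Nat.digits b p.1).getD i 0 = (Nat.digits b p.2).getD i 0) ∧
      (Nat.digits b p.2).getD y 0 ≤ 2 * (Nat.digits b p.1).getD y 0}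

/-- The glue string `S_t^(m)`, so that `T_{t+1}^(m) = T_t^(m) ++ glue m t`. -/
def glue (m t : ℕ) : List ℕ := (gPrefix (m + 1) (tau m (t + 1))).drop (tau m t)

/-- The strings `P_t^(m)`: `P_1^(m) = (m)` and `P_{t+1}^(m) = P_t^(m)·B_t^(m)·S_t^(m)`. -/
def Pstr (m : ℕ) : ℕ → List ℕ
  | 0 => []
  | 1 => [m]
  | t + 2 => Pstr m (t + 1) ++ Bstr m (t + 1) ++ glue m (t + 1)

end

theorem le_curl_iff {k : ℕ} (hk : 2 ≤ k) (S : List ℕ) :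
    k ≤ curl S ↔ ∃ X Y : List ℕ, Y ≠ [] ∧ S = X ++ (List.replicate k Y).flatten := by
  have hlen : ∀ k, (∃ X Y : List ℕ, Y ≠ [] ∧ S = X ++ (List.replicate k Y).flatten) →
      k ≤ S.length := by
    rintro k ⟨X, Y, hY, rfl⟩
    have : 1 ≤ Y.length := List.length_pos_iff.mpr hY
    simp only [List.length_append, List.length_flatten, List.map_replicate, List.sum_replicate,
      smul_eq_mul]
    nlinarith
  have hb : BddAbove {k | ∃ X Y : List ℕ, Y ≠ [] ∧ S = X ++ (List.replicate k Y).flatten} :=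
    ⟨S.length, fun k hk => hlen k hk⟩
  have hne : {k | ∃ X Y : List ℕ, Y ≠ [] ∧
      S = X ++ (List.replicate k Y).flatten}.Nonempty :=
    ⟨0, S, [0], by simp, by simp⟩
  constructor
  · intro h
    unfold curl at h
    have h2 : k ≤ sSup {k | ∃ X Y : List ℕ, Y ≠ [] ∧
        S = X ++ (List.replicate k Y).flatten} := by
      rcases le_max_iff.mp h with h | h
      · omega
      · exact h
    obtain ⟨X, Y, hY, hS⟩ := Nat.sSup_mem hne hb
    obtain ⟨c, hc⟩ := Nat.exists_eq_add_of_le' h2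
    rw [hc, List.replicate_add, List.flatten_append, ← List.append_assoc] at hS
    exact ⟨_, Y, hY, hS⟩
  · intro h
    exact le_max_of_le_right (le_csSup hb h)

theorem curl_nil : curl [] = 1 := by
  have h : ¬ 2 ≤ curl [] := by
    rw [le_curl_iff le_rfl]
    rintro ⟨X, Y, hY, h⟩
    simp [List.replicate_succ, hY] at h
  have : 1 ≤ curl [] := le_max_left _ _
  omega

theorem one_le_curl (S : List ℕ) : 1 ≤ curl S := le_max_left _ _

/-- The concatenation of the strings `2 :: f 0, …, 2 :: f (n - 1)`. -/
def seg (f : ℕ → List ℕ) : ℕ → List ℕ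
  | 0 => []
  | n + 1 => seg f n ++ 2 :: f n

theorem seg_add (f : ℕ → List ℕ) (j n : ℕ) :
    seg f (j + n) = seg f j ++ seg (fun l => f (j + l)) n := by
  induction n with
  | zero => simp [seg]
  | succ n ih => rw [← add_assoc, seg, seg, ih, List.append_assoc]

theorem seg_congr {f g : ℕ → List ℕ} {n : ℕ} (h : ∀ l < n, f l = g l) : seg f n = seg g n := by
  induction n with
  | zero => rfl
  | succ n ih =>
    rw [seg, seg, ih fun l hl => h l (by omega), h n (by omega)]

theorem count_seg {f : ℕ → List ℕ} (hf : ∀ l, 2 ∉ f l) (n : ℕ) : (seg f n).count 2 = n := by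
  induction n with
  | zero => simp [seg]
  | succ n ih => simp [seg, ih, List.count_eq_zero_of_not_mem (hf n)]

theorem append_two_cons_eq {x Z A r : List ℕ} (hZ : 2 ∉ Z) (h : x ++ 2 :: Z = A ++ 2 :: r) :
    (A = x ∧ r = Z) ∨ ∃ r', x = A ++ 2 :: r' := by
  rcases List.append_eq_append_iff.mp h with ⟨u, hu, hv⟩ | ⟨u, hu, hv⟩
  · cases u with
    | nil => simp at hu hv; exact Or.inl ⟨hu, hv.symm⟩
    | cons c u =>
      simp at hv
      exact absurd (by rw [hv.2]; simp) hZ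
  · cases u with
    | nil => simp at hu hv; exact Or.inl ⟨hu.symm, hv⟩
    | cons c u =>
      simp at hv
      exact Or.inr ⟨u, by rw [hu, hv.1]⟩

theorem eq_seg_of_append_two {f : ℕ → List ℕ} (hf : ∀ l, 2 ∉ f l) {i : ℕ} {Z A r : List ℕ}
    (hZ : 2 ∉ Z) (h : seg f i ++ 2 :: Z = A ++ 2 :: r) : ∃ j ≤ i, A = seg f j := by
  induction i generalizing Z r with
  | zero =>
    rcases append_two_cons_eq hZ h with h | ⟨r', h⟩
    · exact ⟨0, le_rfl, h.1⟩
    · simp [seg] at h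
  | succ i ih =>
    rcases append_two_cons_eq hZ h with h | ⟨r', h⟩
    · exact ⟨i + 1, le_rfl, h.1⟩
    · obtain ⟨j, hj, h'⟩ := ih (hf i) h
      exact ⟨j, by omega, h'⟩

theorem append_two_cons_inj {x Z x' Z' : List ℕ} (hZ : 2 ∉ Z) (hZ' : 2 ∉ Z')
    (h : x ++ 2 :: Z = x' ++ 2 :: Z') : x = x' ∧ Z = Z' := by
  rcases append_two_cons_eq hZ h with h1 | ⟨r, h1⟩
  · exact ⟨h1.1.symm, h1.2.symm⟩
  · rw [h1, List.append_assoc, List.append_cancel_left_eq] at h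
    simp at h
    exact absurd (by rw [← h]; simp) hZ'

theorem seg_append_inj {f g : ℕ → List ℕ} (hf : ∀ l, 2 ∉ f l) (hg : ∀ l, 2 ∉ g l) {n n' : ℕ}
    {Z Z' : List ℕ} (hZ : 2 ∉ Z) (hZ' : 2 ∉ Z') (h : seg f n ++ 2 :: Z = seg g n' ++ 2 :: Z') :
    n = n' ∧ Z = Z' ∧ ∀ l < n, f l = g l := by
  induction n generalizing n' Z Z' with
  | zero =>
    obtain ⟨h1, h2⟩ := append_two_cons_inj hZ hZ' h
    cases n' with
    | zero => exact ⟨rfl, h2, by simp⟩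
    | succ n' => simp [seg] at h1
  | succ n ih =>
    obtain ⟨h1, h2⟩ := append_two_cons_inj hZ hZ' h
    cases n' with
    | zero => simp [seg] at h1
    | succ n' =>
      obtain ⟨h3, h4, h5⟩ := ih (hf n) (hg n') h1
      subst h3
      refine ⟨rfl, h2, fun l hl => ?_⟩
      rcases Nat.lt_succ_iff_lt_or_eq.mp hl with h | rfl
      · exact h5 l h
      · exact h4

/-- The blocks of a string with a suffix `Y ^ k`, where `Y` consists of a `2`-free string `s`
followed by the blocks `2 :: g 0, …, 2 :: g (D - 1), 2 :: W`. -/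
theorem blocks_of_power_suffix {f g : ℕ → List ℕ} (hf : ∀ l, 2 ∉ f l) (hg : ∀ l, 2 ∉ g l)
    {s W : List ℕ} {D : ℕ} (hs : 2 ∉ s) (hW : 2 ∉ W) {X : List ℕ} {k i : ℕ} {Z : List ℕ}
    (hZ : 2 ∉ Z)
    (h : seg f i ++ 2 :: Z = X ++ (List.replicate k (s ++ (seg g D ++ 2 :: W))).flatten) :
    (1 ≤ k → Z = W) ∧ k * (D + 1) ≤ i + 1 ∧
    (∀ l < k, ∀ e < D, f (i - l * (D + 1) - D + e) = g e) ∧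
    (∀ l, 1 ≤ l → l < k → f (i - l * (D + 1)) = W ++ s) ∧
    (1 ≤ k → k * (D + 1) ≤ i → s <:+ f (i - k * (D + 1))) ∧
    (1 ≤ k → k * (D + 1) = i + 1 → s = []) := by
  induction k generalizing i Z with
  | zero => simp
  | succ k ih =>
    rw [List.replicate_succ', List.flatten_append, List.flatten_singleton, ← List.append_assoc]
      at h
    set X' := X ++ (List.replicate k (s ++ (seg g D ++ 2 :: W))).flatten with hX'
    obtain ⟨r, hr⟩ : ∃ r, seg g D ++ 2 :: W = 2 :: r := by
      cases D with
      | zero => exact ⟨W, rfl⟩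
      | succ D =>
        clear * -
        induction D with
        | zero => exact ⟨_, rfl⟩
        | succ D ih =>
          obtain ⟨r, hr⟩ := ih
          rw [seg]
          cases hq : seg g (D + 1) with
          | nil => simp [seg] at hq
          | cons c q => rw [hq] at hr; simp at hr; simp [hr.1]
    obtain ⟨j, hj, hA⟩ : ∃ j ≤ i, X' ++ s = seg f j := by
      apply eq_seg_of_append_two hf hZ (r := r)
      exact h.trans (by rw [hr, ← List.append_assoc X' s])
    obtain ⟨n, rfl⟩ := Nat.exists_eq_add_of_le hj
    have h' := h
    rw [seg_add, ← List.append_assoc, hA, List.append_assoc, List.append_cancel_left_eq] at h'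
    obtain ⟨rfl, rfl, hfg⟩ := seg_append_inj (fun l => hf _) hg hZ hW h'
    have hfg0 : ∀ e < n, f (j + n - 0 * (n + 1) - n + e) = g e := by
      intro e he
      rw [← hfg e he]
      congr 1
      omega
    cases j with
    | zero =>
      have h1 : X' = [] ∧ s = [] := by simpa [seg] using hA
      have hk : k = 0 := by
        have h2 := h1.1
        rw [hX'] at h2
        cases k with
        | zero => rfl
        | succ k => simp [List.replicate_succ] at h2
      subst hk
      refine ⟨fun _ => rfl, by simp, ?_, ?_, ?_, fun _ _ => h1.2⟩
      · intro l hl e he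
        obtain rfl : l = 0 := by omega
        exact hfg0 e he
      · intro l hl hl'
        omega
      · intro _ h3
        omega
    | succ j =>
      have hpre : ∃ Z', f j = Z' ++ s ∧ X' = seg f j ++ 2 :: Z' := by
        rw [seg] at hA
        rcases List.append_eq_append_iff.mp hA with ⟨u, hu, hv⟩ | ⟨u, hu, hv⟩
        · exact absurd (by rw [hv]; simp) hs
        · cases u with
          | nil => simp at hv; exact absurd (by rw [← hv]; simp) hs
          | cons c u =>
            simp at hv
            exact ⟨u, hv.2, by rw [hu, hv.1]⟩
      obtain ⟨Z', hZ', hXZ⟩ := hpre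
      have hZ'2 : 2 ∉ Z' := fun h2 => hf j (by rw [hZ']; simp [h2])
      obtain ⟨i1, i2, i3, i4, i5, i6⟩ := ih hZ'2 (by rw [← hXZ])
      have e1 : j + 1 + n - (n + 1) = j := by omega
      have hsub : ∀ l, j + 1 + n - (l + 1) * (n + 1) = j - l * (n + 1) := by
        intro l
        rw [Nat.add_mul, one_mul, Nat.add_comm (l * (n+1)), ← Nat.sub_sub, e1]
      refine ⟨fun _ => rfl, by rw [Nat.add_mul]; omega, ?_, ?_, ?_, ?_⟩
      · intro l hl e he
        cases l with
        | zero => exact hfg0 e he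
        | succ l => rw [hsub]; exact i3 l (by omega) e he
      · intro l hl hl'
        obtain ⟨l, rfl⟩ := Nat.exists_eq_add_of_le' hl
        rw [hsub]
        cases l with
        | zero => rw [zero_mul, Nat.sub_zero, hZ', i1 (by omega)]
        | succ l => exact i4 _ (by omega) (by omega)
      · intro _ h3
        rw [hsub]
        rcases Nat.eq_zero_or_pos k with rfl | hk
        · simp [hZ']
        · exact i5 hk (by rw [Nat.add_mul] at h3; omega)
      · intro _ h3
        rw [Nat.add_mul] at h3
        have : 1 ≤ k := by
          rcases Nat.eq_zero_or_pos k with rfl | hk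
          · omega
          · exact hk
        exact i6 this (by omega)

theorem two_le_curl_seg {f : ℕ → List ℕ} {c D : ℕ} {Z s : List ℕ}
    (h : ∀ e < D, f (c + e) = f (c + D + 1 + e)) (hD : f (c + D) = Z ++ s)
    (hs : s <:+ seg f c) : 2 ≤ curl (seg f (c + D + 1 + D) ++ 2 :: Z) := by
  rw [le_curl_iff le_rfl]
  obtain ⟨X, hX⟩ := hs
  refine ⟨X, s ++ (seg (fun l => f (c + l)) D ++ 2 :: Z), by simp, ?_⟩
  rw [seg_add f (c + D + 1) D, seg_congr (fun l hl => (h l hl).symm), seg, seg_add f c D, hD, ← hX]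
  simp [List.replicate_succ]

theorem three_le_curl_seg {f : ℕ → List ℕ} {c D : ℕ} {Z : List ℕ}
    (h1 : ∀ e < D, f (c + e) = f (c + D + 1 + e))
    (h2 : ∀ e < D, f (c + e) = f (c + D + 1 + D + 1 + e))
    (hD : f (c + D) = Z) (hD' : f (c + D + 1 + D) = Z) :
    3 ≤ curl (seg f (c + D + 1 + D + 1 + D) ++ 2 :: Z) := by
  rw [le_curl_iff (by norm_num)]
  refine ⟨seg f c, seg (fun l => f (c + l)) D ++ 2 :: Z, by simp, ?_⟩
  rw [seg_add f (c + D + 1 + D + 1) D, seg_congr (fun l hl => (h2 l hl).symm), seg,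
    seg_add f (c + D + 1) D, seg_congr (fun l hl => (h1 l hl).symm), seg, seg_add f c D, hD, hD']
  simp [List.replicate_succ]

theorem pow_dvd_iff_le_padicValNat {n : ℕ} (hn : 0 < n) (e : ℕ) :
    3 ^ e ∣ n ↔ e ≤ padicValNat 3 n :=
  padicValNat_dvd_iff_le hn.ne'

theorem padicValNat_eq_of_add_pow_mul {a b e c : ℕ} (hb : 0 < b) (h : a = b + 3 ^ e * c)
    (ha' : ¬ 3 ^ (e + 1) ∣ a) (hb' : ¬ 3 ^ (e + 1) ∣ b) : padicValNat 3 a = padicValNat 3 b := by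
  have ha : 0 < a := by omega
  rw [pow_dvd_iff_le_padicValNat ha] at ha'
  rw [pow_dvd_iff_le_padicValNat hb] at hb'
  have key : ∀ t ≤ e, (t ≤ padicValNat 3 a ↔ t ≤ padicValNat 3 b) := by
    intro t ht
    rw [← pow_dvd_iff_le_padicValNat ha, ← pow_dvd_iff_le_padicValNat hb, h]
    exact Nat.dvd_add_iff_left (Dvd.dvd.mul_right (pow_dvd_pow 3 ht) c) |>.symm
  have h1 := (key (padicValNat 3 a) (by omega)).mp le_rfl
  have h2 := (key (padicValNat 3 b) (by omega)).mpr le_rfl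
  omega

theorem three_pow_succ_dvd_mul {e q : ℕ} : 3 ^ (e + 1) ∣ 3 ^ e * q ↔ 3 ∣ q := by
  rw [pow_succ]
  exact Nat.mul_dvd_mul_iff_left (by positivity)

theorem exists_eq_pow_mul {n : ℕ} (hn : 0 < n) :
    ∃ c, n = 3 ^ padicValNat 3 n * c ∧ c % 3 ≠ 0 := by
  obtain ⟨c, hc⟩ := (pow_dvd_iff_le_padicValNat hn _).mpr le_rfl
  refine ⟨c, hc, fun h => ?_⟩
  have h1 := (three_pow_succ_dvd_mul (e := padicValNat 3 n)).mpr (Nat.dvd_of_mod_eq_zero h)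
  rw [← hc, pow_dvd_iff_le_padicValNat hn] at h1
  omega

theorem padicValNat_three_pow_mul {e c : ℕ} (hc : c % 3 ≠ 0) : padicValNat 3 (3 ^ e * c) = e := by
  have hn : 0 < 3 ^ e * c := Nat.mul_pos (by positivity) (by omega)
  have h1 := (pow_dvd_iff_le_padicValNat hn e).mp (Dvd.intro c rfl)
  by_contra hne
  have h2 := (pow_dvd_iff_le_padicValNat hn (e + 1)).mpr (by omega)
  rw [three_pow_succ_dvd_mul] at h2
  omega

/-- A cube in the ternary ruler sequence, with the last term ignored, has period a power of `3`. -/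
theorem ruler_cube {N d : ℕ} (hd : 1 ≤ d) (hN : 3 * d ≤ N)
    (h1 : ∀ e, 1 ≤ e → e < d → padicValNat 3 (N - d - e) = padicValNat 3 (N - e))
    (h2 : ∀ e, 1 ≤ e → e < d → padicValNat 3 (N - 2 * d - e) = padicValNat 3 (N - e))
    (h3 : padicValNat 3 (N - d) = padicValNat 3 (N - 2 * d)) :
    ∃ e w, d = 3 ^ e ∧ N = 3 ^ e * (3 * w) ∧ padicValNat 3 (N - d) = e := by
  obtain ⟨c, hc, hc3⟩ := exists_eq_pow_mul hd
  set e := padicValNat 3 d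
  have hpos : 0 < 3 ^ e := by positivity
  -- no multiple of `3 ^ e` lies strictly between `N - d` and `N`
  have key : ∀ q, N - d < 3 ^ e * q → 3 ^ e * q < N → False := by
    intro q hq1 hq2
    have hcq : 2 * c < q := by
      have : 3 ^ e * (2 * c) < 3 ^ e * q := by
        rw [mul_left_comm, ← hc]; omega
      exact Nat.lt_of_mul_lt_mul_left this
    have a1 := h1 (N - 3 ^ e * q) (by omega) (by omega)
    have a2 := h2 (N - 3 ^ e * q) (by omega) (by omega)
    have b0 : N - (N - 3 ^ e * q) = 3 ^ e * q := by omega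
    have b1 : N - d - (N - 3 ^ e * q) = 3 ^ e * (q - c) := by rw [Nat.mul_sub, ← hc]; omega
    have b2 : N - 2 * d - (N - 3 ^ e * q) = 3 ^ e * (q - 2 * c) := by
      rw [Nat.mul_sub, mul_left_comm, ← hc]; omega
    rw [b0, b1] at a1
    rw [b0, b2] at a2
    have p0 : 0 < 3 ^ e * q := Nat.mul_pos hpos (by omega)
    have p1 : 0 < 3 ^ e * (q - c) := Nat.mul_pos hpos (by omega)
    have p2 : 0 < 3 ^ e * (q - 2 * c) := Nat.mul_pos hpos (by omega)
    have d0 := pow_dvd_iff_le_padicValNat p0 (e + 1)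
    have d1 := pow_dvd_iff_le_padicValNat p1 (e + 1)
    have d2 := pow_dvd_iff_le_padicValNat p2 (e + 1)
    rw [three_pow_succ_dvd_mul] at d0 d1 d2
    have hmod : 3 ∣ q ∨ 3 ∣ q - c ∨ 3 ∣ q - 2 * c := by
      have hc' : c % 3 = 1 ∨ c % 3 = 2 := by omega
      have hq' : q % 3 = 0 ∨ q % 3 = 1 ∨ q % 3 = 2 := by omega
      rcases hc' with hc' | hc' <;> rcases hq' with hq' | hq' | hq' <;> omega
    have hmod' : ¬ (3 ∣ q ∧ 3 ∣ q - c) := by omega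
    rw [d0, d1, d2, a1, a2] at hmod
    rw [d0, d1, a1] at hmod'
    tauto
  have hle : d ≤ (N - 1) % 3 ^ e + 1 := by
    by_contra hlt
    have := Nat.div_add_mod (N - 1) (3 ^ e)
    exact key ((N - 1) / 3 ^ e) (by omega) (by omega)
  have hlt := Nat.mod_lt (N - 1) hpos
  have hde : 3 ^ e ≤ d := by rw [hc]; exact Nat.le_mul_of_pos_right _ (by omega)
  have hd3 : d = 3 ^ e := by omega
  have hdiv := Nat.div_add_mod (N - 1) (3 ^ e)
  obtain ⟨q, hq⟩ : ∃ q, N = 3 ^ e * q := ⟨(N - 1) / 3 ^ e + 1, by rw [Nat.mul_add]; omega⟩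
  have hq3 : 3 ≤ q := by
    have : 3 ^ e * 3 ≤ 3 ^ e * q := by rw [← hq]; omega
    exact Nat.le_of_mul_le_mul_left this hpos
  have e1 : N - d = 3 ^ e * (q - 1) := by rw [Nat.mul_sub, ← hq, ← hd3, mul_one]
  have e2 : N - 2 * d = 3 ^ e * (q - 2) := by rw [Nat.mul_sub, ← hq, hd3, mul_comm 2]
  have p1 : 0 < 3 ^ e * (q - 1) := Nat.mul_pos hpos (by omega)
  have p2 : 0 < 3 ^ e * (q - 2) := Nat.mul_pos hpos (by omega)
  have d1 := pow_dvd_iff_le_padicValNat p1 (e + 1)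
  have d2 := pow_dvd_iff_le_padicValNat p2 (e + 1)
  rw [three_pow_succ_dvd_mul] at d1 d2
  rw [e1, e2] at h3
  have hq0 : q % 3 = 0 := by omega
  refine ⟨e, q / 3, hd3, by rw [Nat.mul_div_cancel' (Nat.dvd_of_mod_eq_zero hq0)]; exact hq, ?_⟩
  rw [e1]
  exact padicValNat_three_pow_mul (by omega)

theorem ruler_square {N d : ℕ} (hd : 1 ≤ d) (hN : 2 * d ≤ N) (hdig : ∀ e, N / 3 ^ e % 3 ≠ 2)
    (h1 : ∀ e, 1 ≤ e → e < d → padicValNat 3 (N - d - e) = padicValNat 3 (N - e))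
    (h2 : padicValNat 3 N ≤ padicValNat 3 (N - d)) :
    d = 3 ^ padicValNat 3 N ∧ 2 * d < N ∧ padicValNat 3 (N - 2 * d) = padicValNat 3 N ∧
      padicValNat 3 N < padicValNat 3 (N - d) := by
  rcases h2.eq_or_lt with h2 | h2
  · exfalso
    obtain ⟨c, hc, hc3⟩ := exists_eq_pow_mul hd
    set e := padicValNat 3 d
    have hpos : 0 < 3 ^ e := by positivity
    obtain ⟨q, hq⟩ : ∃ q, N / 3 ^ e = q := ⟨_, rfl⟩
    have hdig' := hdig e
    rw [hq] at hdig'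
    have hdiv := Nat.div_add_mod N (3 ^ e)
    have hlt := Nat.mod_lt N hpos
    rw [hq] at hdiv
    have hcq : 2 * c ≤ q := by
      by_contra hcon
      have h3 : 3 ^ e * (q + 1) ≤ 3 ^ e * (2 * c) := Nat.mul_le_mul_left _ (by omega)
      rw [mul_left_comm, ← hc, Nat.mul_add] at h3
      omega
    have key : ∀ q', q < q' + c → q' ≤ q → q' % 3 ≠ 0 ∧ (q' - c) % 3 ≠ 0 := by
      intro q' hq1 hq2
      have g1 : 3 ^ e * q' ≤ 3 ^ e * q := Nat.mul_le_mul_left _ hq2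
      have g2 : 3 ^ e * (q + 1) ≤ 3 ^ e * (q' + c) := Nat.mul_le_mul_left _ (by omega)
      rw [Nat.mul_add, Nat.mul_add, ← hc] at g2
      have b1 : N - d - (N - 3 ^ e * q') = 3 ^ e * (q' - c) := by rw [Nat.mul_sub, ← hc]; omega
      have b0 : N - (N - 3 ^ e * q') = 3 ^ e * q' := by omega
      have a1 : padicValNat 3 (3 ^ e * (q' - c)) = padicValNat 3 (3 ^ e * q') := by
        rw [← b0, ← b1]
        rcases Nat.eq_zero_or_pos (N - 3 ^ e * q') with h0 | h0
        · rw [h0, Nat.sub_zero, Nat.sub_zero, h2]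
        · rw [h1 _ h0 (by omega)]
      have p0 : 0 < 3 ^ e * q' := Nat.mul_pos hpos (by omega)
      have p1 : 0 < 3 ^ e * (q' - c) := Nat.mul_pos hpos (by omega)
      have d0 := pow_dvd_iff_le_padicValNat p0 (e + 1)
      have d1 := pow_dvd_iff_le_padicValNat p1 (e + 1)
      rw [three_pow_succ_dvd_mul] at d0 d1
      omega
    have k0 := key q (by omega) le_rfl
    rcases Nat.lt_or_ge c 2 with hc2 | hc2
    · omega
    · have k1 := key (q - 1) (by omega) (by omega)
      omega
  · have hNp : 0 < N := by omega
    obtain ⟨w, hw, hw3⟩ := exists_eq_pow_mul hNp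
    set α := padicValNat 3 N
    have hpos : 0 < 3 ^ α := by positivity
    have hdvd : 3 ^ (α + 1) ∣ N - d := (pow_dvd_iff_le_padicValNat (by omega) _).mpr h2
    obtain ⟨c, hc⟩ : 3 ^ α ∣ d := by
      have h3 : 3 ^ α ∣ N := Dvd.intro w hw.symm
      have h4 : 3 ^ α ∣ N - d := (pow_dvd_pow 3 (Nat.le_succ α)).trans hdvd
      have h5 := Nat.dvd_sub h3 h4
      rwa [Nat.sub_sub_self (by omega)] at h5
    have hcw : 2 * c ≤ w := by
      have : 3 ^ α * (2 * c) ≤ 3 ^ α * w := by rw [mul_left_comm, ← hc, ← hw]; exact hN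
      exact Nat.le_of_mul_le_mul_left this hpos
    have hc0 : 0 < c := by
      rcases Nat.eq_zero_or_pos c with h0 | h0
      · rw [h0, mul_zero] at hc; omega
      · exact h0
    have hw1 : w % 3 = 1 := by
      have h3 := hdig α
      have h4 : N / 3 ^ α = w := by
        conv_lhs => rw [hw]
        exact Nat.mul_div_cancel_left _ hpos
      rw [h4] at h3
      omega
    have hwc : (w - c) % 3 = 0 := by
      have h3 : N - d = 3 ^ α * (w - c) := by rw [Nat.mul_sub, ← hc, ← hw]
      rw [h3, three_pow_succ_dvd_mul] at hdvd
      omega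
    have key : ∀ j, 1 ≤ j → j < c → (w - j) % 3 ≠ 0 := by
      intro j hj1 hj2
      have g : 3 ^ α * (j + 1) ≤ 3 ^ α * c := Nat.mul_le_mul_left _ (by omega)
      have g1 : 3 ^ α * 1 ≤ 3 ^ α * j := Nat.mul_le_mul_left _ (by omega)
      rw [Nat.mul_add] at g
      have a1 := h1 (3 ^ α * j) (by omega) (by omega)
      have b0 : N - 3 ^ α * j = 3 ^ α * (w - j) := by rw [Nat.mul_sub, ← hw]
      have b1 : N - d - 3 ^ α * j = 3 ^ α * (w - c - j) := by
        rw [Nat.mul_sub, Nat.mul_sub, ← hw, ← hc]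
      rw [b0, b1] at a1
      have p0 : 0 < 3 ^ α * (w - j) := Nat.mul_pos hpos (by omega)
      have p1 : 0 < 3 ^ α * (w - c - j) := Nat.mul_pos hpos (by omega)
      have d0 := pow_dvd_iff_le_padicValNat p0 (α + 1)
      have d1 := pow_dvd_iff_le_padicValNat p1 (α + 1)
      rw [three_pow_succ_dvd_mul] at d0 d1
      omega
    have hc1 : c = 1 := by
      by_contra hne
      have := key 1 le_rfl (by omega)
      omega
    subst hc1
    rw [mul_one] at hc
    refine ⟨hc, ?_, ?_, h2⟩
    · have : 3 ^ α * 3 ≤ 3 ^ α * w := Nat.mul_le_mul_left _ (by omega)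
      rw [← hw] at this
      omega
    · have h3 : N - 2 * d = 3 ^ α * (w - 2) := by rw [Nat.mul_sub, ← hw, hc, mul_comm 2]
      rw [h3]
      exact padicValNat_three_pow_mul (by omega)

/-- The `i`-th block (0-indexed) of the concatenation of `2 :: U (ord_3 1)`, `2 :: U (ord_3 2)`, … -/
def rulerBlock (U : ℕ → List ℕ) (i : ℕ) : List ℕ := U (padicValNat 3 (i + 1))

theorem power_suffix_ruler {U : ℕ → List ℕ} (hU2 : ∀ v, 2 ∉ U v)
    (hU : StrictMono fun v => (U v).length) {k i : ℕ} {Z X Y : List ℕ} (hk : 1 ≤ k) (hZ : 2 ∉ Z)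
    (h : seg (rulerBlock U) i ++ 2 :: Z = X ++ (List.replicate k Y).flatten) :
    (∃ X', Z = X' ++ (List.replicate k Y).flatten) ∨
    ∃ d s, 1 ≤ d ∧ k * d ≤ i + 1 ∧
      (∀ l < k, ∀ e, 1 ≤ e → e < d →
        padicValNat 3 (i + 1 - l * d - e) = padicValNat 3 (i + 1 - e)) ∧
      (∀ l, 1 ≤ l → l < k → U (padicValNat 3 (i + 1 - l * d)) = Z ++ s) ∧
      (k * d ≤ i → s <:+ U (padicValNat 3 (i + 1 - k * d))) ∧ (k * d = i + 1 → s = []) := by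
  have hinj : Function.Injective U := fun a b hab => hU.injective (by simp [hab])
  have hf : ∀ l, 2 ∉ rulerBlock U l := fun l => hU2 _
  by_cases hY : 2 ∈ Y
  · right
    obtain ⟨s, r, rfl, hs⟩ := List.eq_append_cons_of_mem hY
    obtain ⟨D, g, hg, hr⟩ : ∃ D g, (∀ l, 2 ∉ g l) ∧ 2 :: r = seg g D ++ 2 :: Z := by
      obtain ⟨k, rfl⟩ := Nat.exists_eq_add_of_le' hk
      have h' := h
      rw [List.replicate_succ', List.flatten_append, List.flatten_singleton, ← List.append_assoc,
        ← List.append_assoc] at h'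
      obtain ⟨j, hj, hA⟩ := eq_seg_of_append_two hf hZ h'
      obtain ⟨n, rfl⟩ := Nat.exists_eq_add_of_le hj
      rw [hA, seg_add, List.append_assoc, List.append_cancel_left_eq] at h'
      exact ⟨n, _, fun l => hf _, h'.symm⟩
    rw [hr] at h
    obtain ⟨h1, h2, h3, h4, h5, h6⟩ := blocks_of_power_suffix hf hg hs hZ hZ h
    have hpos : ∀ l < k, l * (D + 1) + (D + 1) ≤ i + 1 := by
      intro l hl
      calc l * (D + 1) + (D + 1) = (l + 1) * (D + 1) := by ring
        _ ≤ k * (D + 1) := Nat.mul_le_mul_right _ hl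
        _ ≤ i + 1 := h2
    refine ⟨D + 1, s, by omega, h2, ?_, ?_, ?_, h6 hk⟩
    · intro l hl e he1 he2
      have p := hpos l hl
      have p0 := hpos 0 hk
      have a := h3 l hl (D - e) (by omega)
      have b := h3 0 hk (D - e) (by omega)
      rw [← b] at a
      have a' := hinj a
      rw [show i - l * (D + 1) - D + (D - e) + 1 = i + 1 - l * (D + 1) - e by omega,
        show i - 0 * (D + 1) - D + (D - e) + 1 = i + 1 - e by omega] at a'
      exact a'
    · intro l hl1 hl2
      rw [← h4 l hl1 hl2]
      have p := hpos l hl2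
      unfold rulerBlock
      congr 2
      omega
    · intro hkd
      have := h5 hk hkd
      unfold rulerBlock at this
      rwa [show i - k * (D + 1) + 1 = i + 1 - k * (D + 1) by omega] at this
  · left
    have hQ : 2 ∉ (List.replicate k Y).flatten := by
      simp only [List.mem_flatten, List.mem_replicate, not_exists, not_and]
      rintro l ⟨-, rfl⟩
      exact hY
    rcases List.append_eq_append_iff.mp h with ⟨u, hu, hv⟩ | ⟨u, hu, hv⟩
    · cases u with
      | nil => simp at hv; exact absurd (by rw [← hv]; simp) hQ
      | cons c u => simp at hv; exact ⟨u, hv.2⟩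
    · exact absurd (by rw [hv]; simp) hQ

theorem le_curl_of_le_curl_ruler {U : ℕ → List ℕ} (hU2 : ∀ v, 2 ∉ U v)
    (hU : StrictMono fun v => (U v).length) {k i : ℕ} {Z : List ℕ} (hk : 3 ≤ k) (hZ : 2 ∉ Z)
    (h : k ≤ curl (seg (rulerBlock U) i ++ 2 :: Z)) :
    k ≤ curl Z ∨ (k = 3 ∧ Z.length < (U (padicValNat 3 (i + 1))).length) := by
  rw [le_curl_iff (by omega)] at h ⊢
  obtain ⟨X, Y, hY, h⟩ := h
  rcases power_suffix_ruler hU2 hU (by omega) hZ h with ⟨X', hX'⟩ | ⟨d, s, hd, hkd, h1, h2, -, -⟩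
  · exact Or.inl ⟨X', Y, hY, hX'⟩
  right
  have hinj : Function.Injective U := fun a b hab => hU.injective (by simp [hab])
  have hkd3 : 3 * d ≤ k * d := Nat.mul_le_mul_right _ hk
  have e1 := h2 1 le_rfl (by omega)
  have e2 := h2 2 (by norm_num) (by omega)
  rw [one_mul] at e1
  obtain ⟨e, w, rfl, hw, he⟩ := ruler_cube hd (N := i + 1) (by omega)
    (fun e he1 he2 => by simpa using h1 1 (by omega) e he1 he2)
    (fun e he1 he2 => h1 2 (by omega) e he1 he2) (hinj (e1.trans e2.symm))
  constructor
  · by_contra hne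
    have hkd4 : 4 * 3 ^ e ≤ k * 3 ^ e := Nat.mul_le_mul_right _ (by omega)
    have e3 := hinj (e1.trans (h2 3 (by norm_num) (by omega)).symm)
    rw [he] at e3
    have h4 := (pow_dvd_iff_le_padicValNat (n := i + 1 - 3 * 3 ^ e) (by omega) (e + 1)).mp (by
      rw [hw, mul_comm 3 (3 ^ e), ← Nat.mul_sub, three_pow_succ_dvd_mul]
      omega)
    omega
  · have h4 := (pow_dvd_iff_le_padicValNat (n := i + 1) (by omega) (e + 1)).mp (by
      rw [hw, three_pow_succ_dvd_mul]
      omega)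
    have h5 : (U e).length < (U (padicValNat 3 (i + 1))).length := hU (by omega)
    have h6 : Z.length ≤ (U e).length := by rw [← he, e1]; simp
    omega

theorem three_le_curl_ruler {U : ℕ → List ℕ} {i u : ℕ} (h : u < padicValNat 3 (i + 1)) :
    3 ≤ curl (seg (rulerBlock U) i ++ 2 :: U u) := by
  obtain ⟨w, hw⟩ := (pow_dvd_iff_le_padicValNat (n := i + 1) (by omega) (u + 1)).mpr h
  have hw0 : 0 < w := by
    rcases Nat.eq_zero_or_pos w with rfl | h0
    · simp at hw
    · exact h0
  have hpos : 0 < 3 ^ u := by positivity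
  obtain ⟨D, hD⟩ : ∃ D, 3 ^ u = D + 1 := Nat.exists_eq_add_of_le' hpos
  obtain ⟨w, rfl⟩ : ∃ w', w = w' + 1 := Nat.exists_eq_add_of_le' hw0
  obtain ⟨c, hc⟩ : ∃ c, 3 ^ (u + 1) * w = c := ⟨_, rfl⟩
  have hc' : c = 3 ^ u * (3 * w) := by rw [← hc]; ring
  have hi : i = c + D + 1 + D + 1 + D := by
    rw [mul_add, hc, mul_one, pow_succ, hD] at hw
    omega
  have hnd : ∀ a b, a < D → ¬ 3 ^ (u + 1) ∣ c + 3 ^ u * b + (a + 1) := by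
    intro a b ha hdvd
    have h1 : 3 ^ u ∣ c + 3 ^ u * b + (a + 1) := (pow_dvd_pow 3 (Nat.le_succ u)).trans hdvd
    rw [hc', ← mul_add, ← Nat.dvd_add_iff_right (Dvd.intro _ rfl)] at h1
    have := Nat.le_of_dvd (by omega) h1
    omega
  rw [hi]
  apply three_le_curl_seg
  · intro e he
    unfold rulerBlock
    congr 1
    refine (padicValNat_eq_of_add_pow_mul (e := u) (c := 1) (by omega) (by omega) ?_ ?_).symm
    · have := hnd e 1 he
      rwa [show c + D + 1 + e + 1 = c + 3 ^ u * 1 + (e + 1) by omega]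
    · simpa [add_assoc] using hnd e 0 he
  · intro e he
    unfold rulerBlock
    congr 1
    refine (padicValNat_eq_of_add_pow_mul (e := u) (c := 2) (by omega) (by omega) ?_ ?_).symm
    · have := hnd e 2 he
      rwa [show c + D + 1 + D + 1 + e + 1 = c + 3 ^ u * 2 + (e + 1) by omega]
    · simpa [add_assoc] using hnd e 0 he
  · unfold rulerBlock
    rw [show c + D + 1 = 3 ^ u * (3 * w + 1) by rw [mul_add, ← hc']; omega]
    rw [padicValNat_three_pow_mul (by omega)]
  · unfold rulerBlock
    rw [show c + D + 1 + D + 1 = 3 ^ u * (3 * w + 2) by rw [mul_add, ← hc']; omega]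
    rw [padicValNat_three_pow_mul (by omega)]

theorem curl_seg_ruler_le_one_iff {U : ℕ → List ℕ} (hU2 : ∀ v, 2 ∉ U v)
    (hU : StrictMono fun v => (U v).length) {i : ℕ} :
    curl (seg (rulerBlock U) (i + 1)) ≤ 1 ↔ (∀ e, (i + 1) / 3 ^ e % 3 ≠ 2) ∧
      curl (U (padicValNat 3 (i + 1))) ≤ 1 ∧
      (3 ^ padicValNat 3 (i + 1) < i + 1 →
        ¬ ∃ s, s <:+ U (padicValNat 3 (i + 1)) ∧ U (padicValNat 3 (i + 1)) ++ s =
          U (padicValNat 3 (i + 1 - 3 ^ padicValNat 3 (i + 1)))) := by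
  have hinj : Function.Injective U := fun a b hab => hU.injective (by simp [hab])
  have hseg : seg (rulerBlock U) (i + 1) =
    seg (rulerBlock U) i ++ 2 :: U (padicValNat 3 (i + 1)) := rfl
  constructor
  · intro hle
    have hdig : ∀ e, (i + 1) / 3 ^ e % 3 ≠ 2 := by
      intro e he
      absurd hle
      rw [not_le]
      have hpos : 0 < 3 ^ e := by positivity
      have hdiv := Nat.div_add_mod (i + 1) (3 ^ e)
      obtain ⟨w, hw⟩ : ∃ w, (i + 1) / 3 ^ e = 3 * w + 2 := ⟨(i + 1) / 3 ^ e / 3, by omega⟩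
      obtain ⟨r, hr⟩ : ∃ r, (i + 1) % 3 ^ e = r := ⟨_, rfl⟩
      have hlt := Nat.mod_lt (i + 1) hpos
      rw [hw, hr] at hdiv
      rw [hr] at hlt
      obtain ⟨D, hD⟩ := Nat.exists_eq_add_of_le' hpos
      obtain ⟨c, hc⟩ : ∃ c, 3 ^ e * (3 * w) = c := ⟨_, rfl⟩
      have hc2 : 3 ^ e * (3 * w + 2) = c + 2 * D + 2 := by rw [mul_add, hc]; omega
      have hi : i = c + r + D + 1 + D := by omega
      have hv : ∀ a, 1 ≤ a → a ≤ 3 ^ e → padicValNat 3 (c + r + a) =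
          padicValNat 3 (c + r + D + 1 + a) := by
        intro a ha1 ha2
        refine (padicValNat_eq_of_add_pow_mul (e := e) (c := 1) (by omega) (by omega) ?_ ?_).symm
        · rintro ⟨t, ht⟩
          have ht' : 3 ^ (e + 1) * t = 3 ^ e * (3 * t) := by ring
          rw [ht'] at ht
          have g1 : 3 ^ e * (3 * w + 1) < 3 ^ e * (3 * t) := by rw [mul_add, hc]; omega
          have g2 : 3 ^ e * (3 * t) < 3 ^ e * (3 * w + 3) := by rw [mul_add, hc]; omega
          have g1' := Nat.lt_of_mul_lt_mul_left g1
          have g2' := Nat.lt_of_mul_lt_mul_left g2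
          omega
        · rintro ⟨t, ht⟩
          have ht' : 3 ^ (e + 1) * t = 3 ^ e * (3 * t) := by ring
          rw [ht'] at ht
          have g1 : 3 ^ e * (3 * w) < 3 ^ e * (3 * t) := by rw [hc]; omega
          have g2 : 3 ^ e * (3 * t) < 3 ^ e * (3 * w + 2) := by rw [mul_add, hc]; omega
          have g1' := Nat.lt_of_mul_lt_mul_left g1
          have g2' := Nat.lt_of_mul_lt_mul_left g2
          omega
      rw [hseg, hi]
      apply two_le_curl_seg (s := [])
      · intro a ha
        exact congrArg U (hv (a + 1) (by omega) (by omega))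
      · rw [List.append_nil]
        exact congrArg U (hv (D + 1) (by omega) (by omega))
      · exact List.nil_suffix
    refine ⟨hdig, ?_, ?_⟩
    · by_contra hgt
      absurd hle
      rw [not_le] at hgt ⊢
      have hgt' : 2 ≤ _ := hgt
      rw [le_curl_iff le_rfl] at hgt'
      obtain ⟨X, Y, hY, hX⟩ := hgt'
      have : 2 ≤ curl (seg (rulerBlock U) (i + 1)) := by
        rw [le_curl_iff le_rfl]
        refine ⟨seg (rulerBlock U) i ++ 2 :: X, Y, hY, ?_⟩
        rw [hseg, hX]
        simp
      exact this
    · rintro hlt ⟨s, hs, hUs⟩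
      absurd hle
      rw [not_le, hseg]
      obtain ⟨w, hw, hw3⟩ := exists_eq_pow_mul (n := i + 1) (by omega)
      set α := padicValNat 3 (i + 1)
      have hpos : 0 < 3 ^ α := by positivity
      have hw1 : w % 3 = 1 := by
        have h3 := hdig α
        have h4 : (i + 1) / 3 ^ α = w := by
          conv_lhs => rw [hw]
          exact Nat.mul_div_cancel_left _ hpos
        rw [h4] at h3
        omega
      have hw4 : 4 ≤ w := by
        have : 3 ^ α * 1 < 3 ^ α * w := by rw [← hw, mul_one]; exact hlt
        have := Nat.lt_of_mul_lt_mul_left this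
        omega
      obtain ⟨D, hD⟩ : ∃ D, 3 ^ α = D + 1 := Nat.exists_eq_add_of_le' hpos
      obtain ⟨w, rfl⟩ : ∃ w', w = w' + 2 := Nat.exists_eq_add_of_le' (by omega)
      have hcpos : 0 < 3 ^ α * w := Nat.mul_pos hpos (by omega)
      obtain ⟨c, hc⟩ : ∃ c, 3 ^ α * w = c + 1 := Nat.exists_eq_add_of_le' hcpos
      rw [mul_add, hc] at hw
      obtain rfl : i = c + 1 + D + 1 + D := by omega
      have hnd : ∀ a b, a < D → ¬ 3 ^ (α + 1) ∣ c + 1 + 3 ^ α * b + (a + 1) := by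
        intro a b ha hdvd
        have h1 : 3 ^ α ∣ c + 1 + 3 ^ α * b + (a + 1) :=
          (pow_dvd_pow 3 (Nat.le_succ α)).trans hdvd
        rw [← hc, ← mul_add, ← Nat.dvd_add_iff_right (Dvd.intro _ rfl)] at h1
        have := Nat.le_of_dvd (by omega) h1
        omega
      apply two_le_curl_seg (s := s)
      · intro e he
        refine congrArg U ?_
        refine (padicValNat_eq_of_add_pow_mul (e := α) (c := 1) (by omega) (by omega) ?_ ?_).symm
        · have := hnd e 1 he
          rwa [show c + 1 + D + 1 + e + 1 = c + 1 + 3 ^ α * 1 + (e + 1) by omega]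
        · simpa [add_assoc] using hnd e 0 he
      · rw [hUs]
        refine congrArg U (congrArg _ ?_)
        omega
      · have h5 : rulerBlock U c = U α := by
          refine congrArg U ?_
          rw [← hc]
          exact padicValNat_three_pow_mul (by omega)
        rw [seg, h5]
        exact hs.trans ((List.suffix_cons _ _).trans (List.suffix_append _ _))
  · rintro ⟨hdig, hQ, hR⟩
    by_contra hgt
    have hgt' : 2 ≤ _ := not_le.mp hgt
    rw [le_curl_iff le_rfl, hseg] at hgt'
    obtain ⟨X, Y, hY, h⟩ := hgt'
    rcases power_suffix_ruler hU2 hU (by omega) (hU2 _) h with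
      ⟨X', hX'⟩ | ⟨d, s, hd, hkd, h1, h2, h3, h4⟩
    · have : 2 ≤ curl (U (padicValNat 3 (i + 1))) := (le_curl_iff le_rfl _).mpr ⟨X', Y, hY, hX'⟩
      omega
    have e1 := h2 1 le_rfl (by omega)
    rw [one_mul] at e1
    have hle : padicValNat 3 (i + 1) ≤ padicValNat 3 (i + 1 - d) := by
      apply hU.le_iff_le.mp
      simp only [e1]
      simp
    obtain ⟨rfl, g1, g2, g3⟩ := ruler_square hd hkd hdig
      (fun e he1 he2 => by simpa using h1 1 (by omega) e he1 he2) hle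
    have h3' := h3 (by omega)
    rw [g2] at h3'
    exact hR (by omega) ⟨s, h3', e1.symm⟩

theorem length_gPrefix (m n : ℕ) : (gPrefix m n).length = n := by
  induction n with
  | zero => rfl
  | succ n ih => simp [gPrefix, ih]

theorem le_of_mem_gPrefix {m n x : ℕ} (h : x ∈ gPrefix m n) : m ≤ x := by
  induction n with
  | zero => simp [gPrefix] at h
  | succ n ih =>
    simp only [gPrefix, List.mem_append, List.mem_singleton] at h
    rcases h with h | h
    · exact ih h
    · rw [h]; exact le_max_left _ _

theorem gPrefix_prefix_of_le (m : ℕ) {a b : ℕ} (h : a ≤ b) : gPrefix m a <+: gPrefix m b := by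
  induction b, h using Nat.le_induction with
  | base => exact List.prefix_rfl
  | succ b _ ih => exact ih.trans (List.prefix_append _ _)

theorem two_not_mem_Tstr (v : ℕ) : 2 ∉ Tstr 2 (v + 1) := fun h => by
  have := le_of_mem_gPrefix h
  omega

theorem length_Tstr (m v : ℕ) : (Tstr m (v + 1)).length =
    Nat.nth (fun k => curl (gPrefix (m + 1) k) ≤ m) v :=
  length_gPrefix _ _

theorem strictMono_length_Tstr (hSH : StandingHyp) :
    StrictMono fun v => (Tstr 2 (v + 1)).length := by
  intro a b hab
  simp only [length_Tstr]
  exact Nat.nth_strictMono (hSH 2 (by norm_num)).2 hab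

/-- The concatenation of the first `n` blocks `2 :: T_{ord_3(i) + 1}^(2)`. -/
noncomputable def ruler (n : ℕ) : List ℕ := seg (rulerBlock fun v => Tstr 2 (v + 1)) n

theorem ruler_append_eq_gPrefix (hSH : StandingHyp) (i l : ℕ)
    (h : ruler i = gPrefix 2 (ruler i).length)
    (hl : l ≤ (Tstr 2 (padicValNat 3 (i + 1) + 1)).length) :
    ruler i ++ 2 :: gPrefix 3 l = gPrefix 2 ((ruler i).length + 1 + l) := by
  have hU2 := two_not_mem_Tstr
  have hU := strictMono_length_Tstr hSH
  have hinf : {k | curl (gPrefix 3 k) ≤ 2}.Infinite := (hSH 2 (by norm_num)).2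
  have hcurl : ∀ v, curl (Tstr 2 (v + 1)) ≤ 2 := fun v =>
    Nat.nth_mem_of_infinite (p := fun k => curl (gPrefix 3 k) ≤ 2) hinf v
  induction l with
  | zero =>
    change _ = gPrefix 2 (ruler i).length ++ [max 2 (curl (gPrefix 2 (ruler i).length))]
    rw [← h]
    suffices hle : curl (ruler i) ≤ 2 by rw [max_eq_left hle]; rfl
    by_contra hgt
    cases i with
    | zero => simp [ruler, seg, curl_nil] at hgt
    | succ i =>
      rcases le_curl_of_le_curl_ruler hU2 hU le_rfl (hU2 _) (not_le.mp hgt) with h1 | ⟨-, h1⟩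
      · have := hcurl (padicValNat 3 (i + 1))
        omega
      · exact lt_irrefl _ h1
  | succ l ih =>
    have ih := ih (by omega)
    rw [← add_assoc, gPrefix, gPrefix, ← ih]
    have h2 : 2 ∉ gPrefix 3 l := fun hmem => by
      have := le_of_mem_gPrefix hmem
      omega
    have hupper : ∀ k, 3 ≤ k → k ≤ curl (ruler i ++ 2 :: gPrefix 3 l) →
        k ≤ max 3 (curl (gPrefix 3 l)) := by
      intro k hk hkc
      rcases le_curl_of_le_curl_ruler hU2 hU hk h2 hkc with h1 | ⟨rfl, -⟩
      · exact le_max_of_le_right h1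
      · exact le_max_left _ _
    have hsuffix : ∀ k, 2 ≤ k → k ≤ curl (gPrefix 3 l) →
        k ≤ curl (ruler i ++ 2 :: gPrefix 3 l) := by
      intro k hk hkc
      rw [le_curl_iff hk] at hkc ⊢
      obtain ⟨X, Y, hY, hX⟩ := hkc
      exact ⟨ruler i ++ 2 :: X, Y, hY, by rw [hX]; simp⟩
    have hthree : 3 ≤ curl (ruler i ++ 2 :: gPrefix 3 l) := by
      by_cases hl3 : 3 ≤ curl (gPrefix 3 l)
      · exact hsuffix 3 (by norm_num) hl3
      · obtain ⟨u, hu⟩ : ∃ u, Nat.nth (fun k => curl (gPrefix 3 k) ≤ 2) u = l := by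
          have : l ∈ Set.range (Nat.nth fun k => curl (gPrefix 3 k) ≤ 2) := by
            rw [Nat.range_nth_of_infinite hinf]
            exact Nat.le_of_lt_succ (not_le.mp hl3)
          exact this
        have hul : (Tstr 2 (u + 1)).length = l := (length_Tstr 2 u).trans hu
        have huT : gPrefix 3 l = Tstr 2 (u + 1) := by rw [← hu]; rfl
        have huv : u < padicValNat 3 (i + 1) := by
          apply hU.lt_iff_lt.mp
          omega
        rw [huT]
        exact three_le_curl_ruler huv
    have heq : max 2 (curl (ruler i ++ 2 :: gPrefix 3 l)) = max 3 (curl (gPrefix 3 l)) := by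
      apply le_antisymm
      · rw [max_eq_right (by omega)]
        exact hupper _ hthree le_rfl
      · apply max_le
        · exact le_max_of_le_right hthree
        · rcases Nat.lt_or_ge (curl (gPrefix 3 l)) 2 with h1 | h1
          · exact le_max_of_le_left h1.le
          · exact le_max_of_le_right (hsuffix _ h1 le_rfl)
    rw [heq]
    simp

theorem ruler_eq_gPrefix (hSH : StandingHyp) (n : ℕ) : ruler n = gPrefix 2 (ruler n).length := by
  induction n with
  | zero => rfl
  | succ n ih =>
    have h1 := ruler_append_eq_gPrefix hSH n _ ih le_rfl
    have h2 : ruler (n + 1) = ruler n ++ 2 :: Tstr 2 (padicValNat 3 (n + 1) + 1) := rfl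
    have h3 : gPrefix 3 (Tstr 2 (padicValNat 3 (n + 1) + 1)).length =
        Tstr 2 (padicValNat 3 (n + 1) + 1) := by
      rw [length_Tstr]; rfl
    rw [h3, ← h2] at h1
    conv_lhs => rw [h1]
    congr 1
    rw [h2]
    simp
    omega

theorem count_ruler (n : ℕ) : (ruler n).count 2 = n := count_seg (fun _ => two_not_mem_Tstr _) n

theorem ruler_strictMono_length : StrictMono fun n => (ruler n).length := by
  apply strictMono_nat_of_lt_succ
  intro n
  simp [ruler, seg]

/-- Prefixes of `A^(2)` followed by a `2` are concatenations of blocks. -/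
theorem exists_ruler_of_curl_le (hSH : StandingHyp) {k : ℕ} (h : curl (gPrefix 2 k) ≤ 2) :
    ∃ j, gPrefix 2 k = ruler j := by
  have h1 : gPrefix 2 (k + 1) = gPrefix 2 k ++ [2] := by rw [gPrefix, max_eq_left h]
  have h2 : k + 1 ≤ (ruler (k + 1)).length := ruler_strictMono_length.id_le (k + 1)
  obtain ⟨r, hr⟩ := gPrefix_prefix_of_le 2 h2
  rw [h1, ← ruler_eq_gPrefix hSH, List.append_assoc] at hr
  obtain ⟨j, -, hj⟩ := eq_seg_of_append_two (fun _ => two_not_mem_Tstr _) (two_not_mem_Tstr _)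
    hr.symm
  exact ⟨j, hj⟩

/-- The positions of the prefixes of `A^(2)` of curling number `1`, counted in blocks. -/
def IsGood (y : ℕ) : Prop := curl (ruler y) ≤ 1

theorem range_count_Tstr (hSH : StandingHyp) :
    StrictMono (fun t => (Tstr 1 (t + 1)).count 2) ∧
      Set.range (fun t => (Tstr 1 (t + 1)).count 2) = {y | IsGood y} := by
  have hinf : {k | curl (gPrefix 2 k) ≤ 1}.Infinite := (hSH 1 le_rfl).2
  have hT : ∀ t, ∃ j, Tstr 1 (t + 1) = ruler j ∧ IsGood j := by
    intro t
    have h1 : curl (Tstr 1 (t + 1)) ≤ 1 :=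
      Nat.nth_mem_of_infinite (p := fun k => curl (gPrefix 2 k) ≤ 1) hinf t
    obtain ⟨j, hj⟩ := exists_ruler_of_curl_le hSH (h1.trans one_le_two)
    refine ⟨j, hj, ?_⟩
    unfold IsGood
    rw [← hj]
    exact h1
  constructor
  · intro a b hab
    obtain ⟨j, hj, -⟩ := hT a
    obtain ⟨j', hj', -⟩ := hT b
    simp only [hj, hj', count_ruler]
    apply ruler_strictMono_length.lt_iff_lt.mp
    simp only [← hj, ← hj', length_Tstr]
    exact Nat.nth_strictMono hinf hab
  · ext y
    constructor
    · rintro ⟨t, rfl⟩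
      obtain ⟨j, hj, hg⟩ := hT t
      change IsGood ((Tstr 1 (t + 1)).count 2)
      rwa [hj, count_ruler]
    · intro hy
      have h1 : (ruler y).length ∈ Set.range (Nat.nth fun k => curl (gPrefix 2 k) ≤ 1) := by
        rw [Nat.range_nth_of_infinite hinf]
        change curl (gPrefix 2 _) ≤ 1
        rw [← ruler_eq_gPrefix hSH]
        exact hy
      obtain ⟨t, ht⟩ := h1
      refine ⟨t, ?_⟩
      have h2 : Tstr 1 (t + 1) = ruler y := by
        rw [ruler_eq_gPrefix hSH, ← ht]; rfl
      simp only [h2, count_ruler]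

theorem isGood_succ_iff (hSH : StandingHyp) (i : ℕ) :
    IsGood (i + 1) ↔ (∀ e, (i + 1) / 3 ^ e % 3 ≠ 2) ∧ padicValNat 3 (i + 1) ∈ Qset ∧
      (3 ^ padicValNat 3 (i + 1) < i + 1 →
        ¬ ∃ s, s <:+ Tstr 2 (padicValNat 3 (i + 1) + 1) ∧ Tstr 2 (padicValNat 3 (i + 1) + 1) ++ s =
          Tstr 2 (padicValNat 3 (i + 1 - 3 ^ padicValNat 3 (i + 1)) + 1)) := by
  unfold IsGood ruler
  rw [curl_seg_ruler_le_one_iff two_not_mem_Tstr (strictMono_length_Tstr hSH)]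
  have hQ : ∀ a, a ∈ Qset ↔ curl (Tstr 2 (a + 1)) ≤ 1 := fun a => by
    have := one_le_curl (Tstr 2 (a + 1))
    change curl (Tstr 2 (a + 1)) = 1 ↔ _
    omega
  rw [hQ]

theorem chi_two_mul_add (a r : ℕ) (hr : r < 2) : chi 2 (2 * a + r) = 3 * chi 2 a + r := by
  unfold chi
  rcases Nat.eq_zero_or_pos (2 * a + r) with h | h
  · obtain ⟨rfl, rfl⟩ : a = 0 ∧ r = 0 := by omega
    simp
  · rw [Nat.digits_def' (by norm_num) h, Nat.ofDigits_cons]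
    rw [show (2 * a + r) / 2 = a by omega, show (2 * a + r) % 2 = r by omega]
    push_cast
    ring

theorem chi_zero : chi 2 0 = 0 := by simp [chi]

/-- Read the base-`3` digits of `z` as base-`2` digits. -/
def unchi (z : ℕ) : ℕ := Nat.ofDigits 2 (Nat.digits 3 z)

theorem unchi_three_mul_add (z r : ℕ) (hr : r < 3) : unchi (3 * z + r) = 2 * unchi z + r := by
  unfold unchi
  rcases Nat.eq_zero_or_pos (3 * z + r) with h | h
  · obtain ⟨rfl, rfl⟩ : z = 0 ∧ r = 0 := by omega
    simp
  · rw [Nat.digits_def' (by norm_num) h, Nat.ofDigits_cons]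
    rw [show (3 * z + r) / 3 = z by omega, show (3 * z + r) % 3 = r by omega]
    ring

theorem unchi_chi (a : ℕ) : unchi (chi 2 a) = a := by
  induction a using Nat.strong_induction_on with
  | _ a ih =>
    rcases Nat.eq_zero_or_pos a with rfl | h
    · simp [chi, unchi]
    · have h1 : a = 2 * (a / 2) + a % 2 := (Nat.div_add_mod a 2).symm
      rw [h1, chi_two_mul_add _ _ (Nat.mod_lt _ (by norm_num)),
        unchi_three_mul_add _ _ (by omega), ih (a / 2) (by omega)]

theorem chi_strictMono : StrictMono (chi 2) := by
  intro a b
  induction b using Nat.strong_induction_on generalizing a with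
  | _ b ih =>
    intro hab
    rw [← Nat.div_add_mod a 2, ← Nat.div_add_mod b 2,
      chi_two_mul_add _ _ (Nat.mod_lt _ (by norm_num)),
      chi_two_mul_add _ _ (Nat.mod_lt _ (by norm_num))]
    rcases Nat.lt_or_ge (a / 2) (b / 2) with h | h
    · have := ih (b / 2) (by omega) h
      omega
    · have : a / 2 = b / 2 := by omega
      rw [this]
      omega

theorem exists_chi_eq_iff (z : ℕ) : (∃ a, z = chi 2 a) ↔ ∀ e, z / 3 ^ e % 3 ≠ 2 := by
  constructor
  · rintro ⟨a, rfl⟩ e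
    induction e generalizing a with
    | zero =>
      rw [← Nat.div_add_mod a 2, chi_two_mul_add _ _ (Nat.mod_lt _ (by norm_num))]
      simp
      omega
    | succ e ih =>
      have h1 : chi 2 a / 3 = chi 2 (a / 2) := by
        conv_lhs => rw [← Nat.div_add_mod a 2, chi_two_mul_add _ _ (Nat.mod_lt _ (by norm_num))]
        omega
      rw [pow_succ', ← Nat.div_div_eq_div_mul, h1]
      exact ih _
  · induction z using Nat.strong_induction_on with
    | _ z ih =>
      intro h
      rcases Nat.eq_zero_or_pos z with rfl | hz
      · exact ⟨0, chi_zero.symm⟩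
      · obtain ⟨a, ha⟩ := ih (z / 3) (by omega) fun e => by
          rw [Nat.div_div_eq_div_mul, ← pow_succ']
          exact h (e + 1)
        have h0 := h 0
        rw [pow_zero, Nat.div_one] at h0
        refine ⟨2 * a + z % 3, ?_⟩
        rw [chi_two_mul_add _ _ (by omega), ← ha]
        omega

theorem chi_two_pow_mul (e w : ℕ) : chi 2 (2 ^ e * w) = 3 ^ e * chi 2 w := by
  induction e with
  | zero => simp
  | succ e ih =>
    rw [pow_succ', mul_assoc, ← add_zero (2 * _), chi_two_mul_add _ _ (by norm_num), ih]
    ring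

theorem isGood_zero : IsGood 0 := by simp [IsGood, ruler, seg, curl_nil]

theorem isGood_chi_iff (hSH : StandingHyp) (α w : ℕ) :
    IsGood (chi 2 (2 ^ α * (2 * w + 1))) ↔ α ∈ Qset ∧ (0 < w →
      ¬ ∃ s, s <:+ Tstr 2 (α + 1) ∧ Tstr 2 (α + 1) ++ s =
          Tstr 2 (α + 1 + padicValNat 3 (chi 2 w) + 1)) := by
  have hz : chi 2 (2 ^ α * (2 * w + 1)) = 3 ^ α * (3 * chi 2 w + 1) := by
    rw [chi_two_pow_mul, chi_two_mul_add _ _ (by norm_num)]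
  have hpos : 0 < 3 ^ α := by positivity
  have hzpos : 0 < chi 2 (2 ^ α * (2 * w + 1)) := by rw [hz]; positivity
  have hw : 0 < chi 2 w ↔ 0 < w := by
    conv_lhs => rw [← chi_zero]
    exact chi_strictMono.lt_iff_lt
  have hdig := (exists_chi_eq_iff (chi 2 (2 ^ α * (2 * w + 1)))).mp ⟨_, rfl⟩
  obtain ⟨i, hi⟩ : ∃ i, chi 2 (2 ^ α * (2 * w + 1)) = i + 1 := Nat.exists_eq_add_of_le' hzpos
  rw [hi] at hdig hz ⊢
  have hv : padicValNat 3 (i + 1) = α := by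
    rw [hz]
    exact padicValNat_three_pow_mul (by omega)
  have hsub : i + 1 - 3 ^ α = 3 ^ (α + 1) * chi 2 w := by
    rw [hz, mul_add, pow_succ, mul_one, Nat.add_sub_cancel, mul_assoc]
  have hlt : 3 ^ α < i + 1 ↔ 0 < w := by
    rw [← hw, hz]
    constructor
    · intro h
      by_contra h0
      have h0' : chi 2 w = 0 := by omega
      simp [h0'] at h
    · intro h
      nlinarith
  rw [isGood_succ_iff hSH, hv, hsub, hlt]
  constructor
  · rintro ⟨-, h1, h2⟩
    refine ⟨h1, fun h0 => ?_⟩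
    have h3 := h2 h0
    rwa [padicValNat.mul (by positivity) (hw.mpr h0).ne', padicValNat.prime_pow] at h3
  · rintro ⟨h1, h2⟩
    refine ⟨hdig, h1, fun h0 => ?_⟩
    have h3 := h2 h0
    rwa [padicValNat.mul (by positivity) (hw.mpr h0).ne', padicValNat.prime_pow]

theorem isGood_chi_pow_iff (hSH : StandingHyp) (α : ℕ) :
    IsGood (chi 2 (2 ^ α)) ↔ α ∈ Qset := by
  have := isGood_chi_iff hSH α 0
  simpa using this

/-- The integer with lowest binary digits `1` at places `α < β`, followed by those of `k`. -/
def twoBits (α β k : ℕ) : ℕ := 2 ^ α + 2 ^ β + 2 ^ (β + 1) * k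

theorem twoBits_eq (α γ k : ℕ) :
    twoBits α (α + 1 + γ) k = 2 ^ α * (2 * (2 ^ γ * (2 * k + 1)) + 1) := by
  unfold twoBits
  ring

theorem isGood_chi_twoBits_iff (hSH : StandingHyp) {α β : ℕ} (h : α < β) (k : ℕ) :
    IsGood (chi 2 (twoBits α β k)) ↔ (α, β) ∈ Rset := by
  obtain ⟨γ, rfl⟩ := Nat.exists_eq_add_of_le h
  have hv : padicValNat 3 (chi 2 (2 ^ γ * (2 * k + 1))) = γ := by
    rw [chi_two_pow_mul, chi_two_mul_add _ _ (by norm_num)]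
    exact padicValNat_three_pow_mul (by omega)
  rw [Nat.succ_eq_add_one, twoBits_eq, isGood_chi_iff hSH, hv]
  unfold Rset
  have hpos : 0 < 2 ^ γ * (2 * k + 1) := by positivity
  simp only [Set.mem_ofPred_eq]
  constructor
  · rintro ⟨h1, h2⟩
    exact ⟨h1, by omega, h2 hpos⟩
  · rintro ⟨h1, -, h2⟩
    exact ⟨h1, fun _ => h2⟩

theorem eq_of_two_pow_mul_odd {α α' w w' : ℕ}
    (h : 2 ^ α * (2 * w + 1) = 2 ^ α' * (2 * w' + 1)) : α = α' ∧ w = w' := by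
  induction α generalizing α' with
  | zero =>
    cases α' with
    | zero => exact ⟨rfl, by simpa using h⟩
    | succ α' => rw [pow_succ', mul_assoc] at h; omega
  | succ α ih =>
    cases α' with
    | zero => rw [pow_succ', mul_assoc] at h; omega
    | succ α' =>
      rw [pow_succ', mul_assoc, pow_succ', mul_assoc] at h
      obtain ⟨h1, h2⟩ := ih (Nat.eq_of_mul_eq_mul_left two_pos h)
      exact ⟨by rw [h1], h2⟩

theorem exists_two_pow_mul_odd {n : ℕ} (hn : 0 < n) : ∃ α w, n = 2 ^ α * (2 * w + 1) := by
  obtain ⟨k, m, ⟨w, rfl⟩, h⟩ := Nat.exists_eq_two_pow_mul_odd hn.ne'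
  exact ⟨k, w, h⟩

theorem twoBits_inj {α β k α' β' k' : ℕ} (h : α < β) (h' : α' < β')
    (heq : twoBits α β k = twoBits α' β' k') : α = α' ∧ β = β' ∧ k = k' := by
  obtain ⟨γ, rfl⟩ := Nat.exists_eq_add_of_le h
  obtain ⟨γ', rfl⟩ := Nat.exists_eq_add_of_le h'
  rw [Nat.succ_eq_add_one, Nat.succ_eq_add_one, twoBits_eq, twoBits_eq] at heq
  obtain ⟨rfl, h2⟩ := eq_of_two_pow_mul_odd heq
  obtain ⟨rfl, h4⟩ := eq_of_two_pow_mul_odd h2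
  exact ⟨rfl, rfl, h4⟩

theorem two_pow_ne_twoBits {a α β k : ℕ} (h : α < β) : 2 ^ a ≠ twoBits α β k := by
  obtain ⟨γ, rfl⟩ := Nat.exists_eq_add_of_le h
  rw [Nat.succ_eq_add_one, twoBits_eq]
  intro heq
  have h1 : 2 ^ a * (2 * 0 + 1) = 2 ^ α * (2 * (2 ^ γ * (2 * k + 1)) + 1) := by simpa using heq
  have h2 := (eq_of_two_pow_mul_odd h1).2
  have : 0 < 2 ^ γ * (2 * k + 1) := by positivity
  omega

theorem eq_zero_or_pow_or_twoBits (n : ℕ) :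
    n = 0 ∨ (∃ α, n = 2 ^ α) ∨ ∃ α β k, α < β ∧ n = twoBits α β k := by
  rcases Nat.eq_zero_or_pos n with h | h
  · exact Or.inl h
  right
  obtain ⟨α, w, rfl⟩ := exists_two_pow_mul_odd h
  rcases Nat.eq_zero_or_pos w with rfl | hw
  · exact Or.inl ⟨α, by simp⟩
  · obtain ⟨γ, k, rfl⟩ := exists_two_pow_mul_odd hw
    exact Or.inr ⟨α, α + 1 + γ, k, by omega, (twoBits_eq _ _ _).symm⟩

theorem twoBits_le_iff {α β k p : ℕ} (h : α < β) :
    twoBits α β k ≤ p ↔ k < (p + 2 ^ β - 2 ^ α) / 2 ^ (β + 1) := by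
  have h1 : 2 ^ α < 2 ^ β := Nat.pow_lt_pow_right (by norm_num) h
  rw [Nat.lt_iff_add_one_le, Nat.le_div_iff_mul_le (by positivity)]
  unfold twoBits
  rw [add_mul, one_mul, mul_comm k, pow_succ]
  omega

theorem range_iota (hSH : StandingHyp) :
    StrictMono (fun t => iota 1 (t + 1)) ∧
      Set.range (fun t => iota 1 (t + 1)) = {a | IsGood (chi 2 a)} := by
  obtain ⟨hmono, hrange⟩ := range_count_Tstr hSH
  have h1 : ∀ t, (Tstr 1 (t + 1)).count 2 = chi 2 (iota 1 (t + 1)) := by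
    intro t
    have h2 : IsGood ((Tstr 1 (t + 1)).count 2) := by
      have : (Tstr 1 (t + 1)).count 2 ∈ {y | IsGood y} := hrange ▸ ⟨t, rfl⟩
      exact this
    obtain ⟨a, ha⟩ : ∃ a, (Tstr 1 (t + 1)).count 2 = chi 2 a := by
      rcases Nat.eq_zero_or_pos ((Tstr 1 (t + 1)).count 2) with h0 | h0
      · exact ⟨0, h0.trans chi_zero.symm⟩
      · obtain ⟨i, hi⟩ : ∃ i, (Tstr 1 (t + 1)).count 2 = i + 1 := Nat.exists_eq_add_of_le' h0
        rw [hi] at h2 ⊢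
        exact (exists_chi_eq_iff _).mpr ((isGood_succ_iff hSH i).mp h2).1
    have h3 : iota 1 (t + 1) = unchi ((Tstr 1 (t + 1)).count 2) := rfl
    rw [h3, ha, unchi_chi]
  constructor
  · intro a b hab
    have := hmono hab
    simp only [h1] at this
    exact chi_strictMono.lt_iff_lt.mp this
  · ext a
    constructor
    · rintro ⟨t, rfl⟩
      change IsGood (chi 2 (iota 1 (t + 1)))
      rw [← h1]
      have : (Tstr 1 (t + 1)).count 2 ∈ {y | IsGood y} := hrange ▸ ⟨t, rfl⟩
      exact this
    · intro ha
      have h2 : chi 2 a ∈ Set.range (fun t => (Tstr 1 (t + 1)).count 2) := hrange ▸ ha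
      obtain ⟨t, ht⟩ := h2
      exact ⟨t, chi_strictMono.injective ((h1 t).symm.trans ht)⟩

theorem sSup_eq_card_of_strictMono {g : ℕ → ℕ} {P : ℕ → Prop} [DecidablePred P]
    (hg : StrictMono fun t => g (t + 1)) (hP : Set.range (fun t => g (t + 1)) = {a | P a})
    (p : ℕ) : sSup {x | 1 ≤ x ∧ g x ≤ p} = ((Finset.range (p + 1)).filter P).card := by
  have hex : ∃ t, p < g (t + 1) := ⟨p + 1, hg.id_le (p + 1)⟩
  obtain ⟨c, hc⟩ : ∃ c, c = Nat.find hex := ⟨_, rfl⟩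
  have hlt : ∀ t, g (t + 1) ≤ p ↔ t < c := by
    intro t
    constructor
    · intro h
      by_contra hct
      have h1 := hg.monotone (not_lt.mp hct)
      have h2 := Nat.find_spec hex
      rw [← hc] at h2
      change g (c + 1) ≤ g (t + 1) at h1
      omega
    · intro h
      rw [hc] at h
      exact not_lt.mp (Nat.find_min hex h)
  have h1 : {x | 1 ≤ x ∧ g x ≤ p} = Set.Icc 1 c := by
    ext x
    constructor
    · rintro ⟨hx1, hx2⟩
      obtain ⟨t, rfl⟩ := Nat.exists_eq_add_of_le' hx1
      exact ⟨hx1, (hlt t).mp hx2⟩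
    · rintro ⟨hx1, hx2⟩
      obtain ⟨t, rfl⟩ := Nat.exists_eq_add_of_le' hx1
      exact ⟨hx1, (hlt t).mpr hx2⟩
  have h2 : (Finset.range (p + 1)).filter P = (Finset.range c).image fun t => g (t + 1) := by
    ext a
    simp only [Finset.mem_filter, Finset.mem_range, Finset.mem_image]
    constructor
    · rintro ⟨ha, hPa⟩
      have : a ∈ Set.range (fun t => g (t + 1)) := hP ▸ hPa
      obtain ⟨t, rfl⟩ := this
      exact ⟨t, (hlt t).mp (by simp only at ha; omega), rfl⟩
    · rintro ⟨t, ht, rfl⟩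
      have h3 : g (t + 1) ∈ {a | P a} := hP ▸ ⟨t, rfl⟩
      exact ⟨by have := (hlt t).mpr ht; omega, h3⟩
  rw [h1, h2, Finset.card_image_of_injective _ hg.injective, Finset.card_range]
  rcases Nat.eq_zero_or_pos c with rfl | h0
  · simp
  · exact csSup_Icc h0

theorem iotaInv_one_eq_card (hSH : StandingHyp) (p : ℕ) :
    iotaInv 1 p = ((Finset.range (p + 1)).filter fun a => IsGood (chi 2 a)).card :=
  sSup_eq_card_of_strictMono (range_iota hSH).1 (range_iota hSH).2 p

theorem iotaInv_one_eq (hSH : StandingHyp) (p : ℕ) : iotaInv 1 p =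
      1 + ((Finset.range (p + 1)).filter (fun a => a ∈ Qset ∧ 2 ^ a ≤ p)).card +
        ∑ q ∈ (Finset.range p ×ˢ Finset.range p).filter
            (fun q => q ∈ Rset ∧ 2 ^ q.2 < p),
          (p + 2 ^ q.2 - 2 ^ q.1) / 2 ^ (q.2 + 1) := by
  set FQ := (Finset.range (p + 1)).filter (fun a => a ∈ Qset ∧ 2 ^ a ≤ p) with hFQ
  set FR := (Finset.range p ×ˢ Finset.range p).filter (fun q => q ∈ Rset ∧ 2 ^ q.2 < p) with hFR
  have hFRlt : ∀ q ∈ FR, q.1 < q.2 := fun q hq => (Finset.mem_filter.mp hq).2.1.2.1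
  have hunion : (Finset.range (p + 1)).filter (fun a => IsGood (chi 2 a)) =
      ({0} ∪ FQ.image fun a => 2 ^ a) ∪ FR.biUnion fun q =>
        (Finset.range ((p + 2 ^ q.2 - 2 ^ q.1) / 2 ^ (q.2 + 1))).image (twoBits q.1 q.2) := by
    ext n
    simp only [Finset.mem_filter, Finset.mem_range, Finset.mem_union, Finset.mem_singleton,
      Finset.mem_image, Finset.mem_biUnion]
    constructor
    · rintro ⟨hn, hgood⟩
      rcases eq_zero_or_pow_or_twoBits n with rfl | ⟨α, rfl⟩ | ⟨α, β, k, hαβ, rfl⟩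
      · exact Or.inl (Or.inl rfl)
      · refine Or.inl (Or.inr ⟨α, ?_, rfl⟩)
        have h1 : α < 2 ^ α := Nat.lt_two_pow_self
        rw [hFQ, Finset.mem_filter, Finset.mem_range]
        exact ⟨by omega, (isGood_chi_pow_iff hSH α).mp hgood, by omega⟩
      · refine Or.inr ⟨(α, β), ?_, k, (twoBits_le_iff hαβ).mp (by omega), rfl⟩
        have h1 : β < 2 ^ β := Nat.lt_two_pow_self
        have h2 : 0 < 2 ^ α := by positivity
        have h3 : 2 ^ β < p := by unfold twoBits at hn; omega
        rw [hFR, Finset.mem_filter, Finset.mem_product, Finset.mem_range, Finset.mem_range]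
        exact ⟨⟨by simp only; omega, by simp only; omega⟩,
          (isGood_chi_twoBits_iff hSH hαβ k).mp hgood, h3⟩
    · rintro ((rfl | ⟨α, hα, rfl⟩) | ⟨q, hq, k, hk, rfl⟩)
      · exact ⟨by omega, by rw [chi_zero]; exact isGood_zero⟩
      · obtain ⟨-, h1, h2⟩ := Finset.mem_filter.mp hα
        exact ⟨by omega, (isGood_chi_pow_iff hSH α).mpr h1⟩
      · have h1 := (twoBits_le_iff (hFRlt q hq)).mpr hk
        exact ⟨by omega, (isGood_chi_twoBits_iff hSH (hFRlt q hq) k).mpr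
          (Finset.mem_filter.mp hq).2.1⟩
  rw [iotaInv_one_eq_card hSH, hunion, Finset.card_union_of_disjoint,
    Finset.card_union_of_disjoint, Finset.card_singleton,
    Finset.card_image_of_injective _ (Nat.pow_right_injective le_rfl), Finset.card_biUnion]
  · congr 1
    refine Finset.sum_congr rfl fun q hq => ?_
    rw [Finset.card_image_of_injective, Finset.card_range]
    intro k k' hk
    exact (twoBits_inj (hFRlt q hq) (hFRlt q hq) hk).2.2
  · intro q hq q' hq' hne
    rw [Function.onFun, Finset.disjoint_left]
    intro n hn hn'
    simp only [Finset.mem_image] at hn hn'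
    obtain ⟨k, -, rfl⟩ := hn
    obtain ⟨k', -, hk'⟩ := hn'
    obtain ⟨h1, h2, -⟩ := twoBits_inj (hFRlt q' hq') (hFRlt q hq) hk'
    exact hne (Prod.ext h1.symm h2.symm)
  · rw [Finset.disjoint_left]
    intro n hn hn'
    simp only [Finset.mem_image, Finset.mem_singleton] at hn hn'
    obtain ⟨a, -, rfl⟩ := hn'
    exact absurd hn (by positivity)
  · rw [Finset.disjoint_left]
    intro n hn hn'
    simp only [Finset.mem_union, Finset.mem_image, Finset.mem_singleton, Finset.mem_biUnion]
      at hn hn'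
    obtain ⟨q, hq, k, -, rfl⟩ := hn'
    rcases hn with hn | ⟨a, -, ha⟩
    · unfold twoBits at hn
      have : 0 < 2 ^ q.1 := by positivity
      have : 0 < 2 ^ q.2 := by positivity
      omega
    · exact two_pow_ne_twoBits (hFRlt q hq) ha

theorem summable_half_pow_snd :
    Summable fun q : ℕ × ℕ => if q.1 < q.2 then (1 / 2 : ℝ) ^ q.2 else 0 := by
  have hg : Summable fun n : ℕ => (3 / 4 : ℝ) ^ n :=
    summable_geometric_of_lt_one (by norm_num) (by norm_num)
  refine Summable.of_nonneg_of_le (fun q => ?_) (fun q => ?_)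
    (hg.mul_of_nonneg hg (fun n => by positivity) (fun n => by positivity))
  · split_ifs <;> positivity
  · split_ifs with h
    · calc (1 / 2 : ℝ) ^ q.2 ≤ (3 / 4 * (3 / 4)) ^ q.2 :=
            pow_le_pow_left₀ (by norm_num) (by norm_num) _
        _ = (3 / 4) ^ q.2 * (3 / 4) ^ q.2 := mul_pow _ _ _
        _ ≤ (3 / 4) ^ q.1 * (3 / 4) ^ q.2 := by
            gcongr ?_ * _
            exact pow_le_pow_of_le_one (by norm_num) (by norm_num) h.le
    · positivity

theorem tsum_Rset : ∑' q : ↥Rset, (1 / 2 : ℝ) ^ ((q : ℕ × ℕ).2 + 1) =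
    ∑' q : ℕ × ℕ, if q ∈ Rset then (1 / 2 : ℝ) ^ (q.2 + 1) else 0 := by
  rw [tsum_subtype Rset fun q => (1 / 2 : ℝ) ^ (q.2 + 1)]
  refine tsum_congr fun q => ?_
  rw [Set.indicator_apply]

theorem abs_div_sub_le {p b a : ℕ} (hp : 0 < p) (hab : a < b) :
    |(((p + 2 ^ b - 2 ^ a) / 2 ^ (b + 1) : ℕ) : ℝ) / p - (1 / 2) ^ (b + 1)| ≤ 1 / p := by
  have hp' : (0 : ℝ) < p := by exact_mod_cast hp
  have hlt : 2 ^ a < 2 ^ b := Nat.pow_lt_pow_right (by norm_num) hab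
  obtain ⟨x, hx⟩ : ∃ x, (p + 2 ^ b - 2 ^ a) / 2 ^ (b + 1) = x := ⟨_, rfl⟩
  have h1 := Nat.div_mul_le_self (p + 2 ^ b - 2 ^ a) (2 ^ (b + 1))
  have h2 := Nat.lt_div_mul_add (a := p + 2 ^ b - 2 ^ a) (b := 2 ^ (b + 1)) (by positivity)
  rw [hx] at h1 h2 ⊢
  have h3 : x * 2 ^ (b + 1) ≤ p + 2 ^ (b + 1) := by
    have : 2 ^ b ≤ 2 ^ (b + 1) := Nat.pow_le_pow_right (by norm_num) (by omega)
    exact h1.trans ((Nat.sub_le _ _).trans (by gcongr))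
  have h4 : p ≤ x * 2 ^ (b + 1) + 2 ^ (b + 1) := by
    refine le_trans ?_ h2.le
    rw [Nat.add_sub_assoc hlt.le]
    exact Nat.le_add_right _ _
  have h3' : (x : ℝ) * 2 ^ (b + 1) ≤ p + 2 ^ (b + 1) := by exact_mod_cast h3
  have h4' : (p : ℝ) ≤ x * 2 ^ (b + 1) + 2 ^ (b + 1) := by exact_mod_cast h4
  have hM : (0 : ℝ) < 2 ^ (b + 1) := by positivity
  rw [one_div_pow, abs_le]
  constructor
  · rw [← sub_nonneg]
    have : (x : ℝ) / p - 1 / 2 ^ (b + 1) - -(1 / p) =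
        (x * 2 ^ (b + 1) + 2 ^ (b + 1) - p) / (p * 2 ^ (b + 1)) := by
      field_simp
      ring
    rw [this]
    exact div_nonneg (by linarith) (by positivity)
  · rw [← sub_nonneg]
    have : 1 / p - ((x : ℝ) / p - 1 / 2 ^ (b + 1)) =
        (p + 2 ^ (b + 1) - x * 2 ^ (b + 1)) / (p * 2 ^ (b + 1)) := by
      field_simp
      ring
    rw [this]
    exact div_nonneg (by linarith) (by positivity)

theorem tendsto_sum_Rset_div :
    Tendsto (fun p : ℕ => ∑' q : ℕ × ℕ, if q ∈ Rset ∧ 2 ^ q.2 < p then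
        (((p + 2 ^ q.2 - 2 ^ q.1) / 2 ^ (q.2 + 1) : ℕ) : ℝ) / p else 0) atTop
      (nhds (∑' q : ℕ × ℕ, if q ∈ Rset then (1 / 2 : ℝ) ^ (q.2 + 1) else 0)) := by
  refine tendsto_tsum_of_dominated_convergence (summable_half_pow_snd.mul_left 2) ?_ ?_
  · intro q
    by_cases hq : q ∈ Rset
    · simp only [hq, true_and, if_true]
      rw [tendsto_iff_norm_sub_tendsto_zero]
      refine squeeze_zero' (Eventually.of_forall fun _ => norm_nonneg _) ?_
        tendsto_one_div_atTop_nhds_zero_nat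
      filter_upwards [eventually_gt_atTop (2 ^ q.2)] with p hp
      rw [if_pos hp]
      exact abs_div_sub_le (lt_of_le_of_lt (Nat.zero_le _) hp) hq.2.1
    · simp [hq]
  · filter_upwards [eventually_gt_atTop 0] with p hp q
    have hnn : (0 : ℝ) ≤ 2 * if q.1 < q.2 then (1 / 2 : ℝ) ^ q.2 else 0 := by
      split_ifs <;> positivity
    split_ifs with h1 h2
    · have hp' : (0 : ℝ) < p := by exact_mod_cast hp
      have h3 := (abs_le.mp (abs_div_sub_le hp h2)).2
      have h4 : (1 : ℝ) / p ≤ (1 / 2) ^ q.2 := by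
        rw [one_div_pow]
        apply one_div_le_one_div_of_le (by positivity)
        exact_mod_cast h1.2.le
      have h5 : (1 / 2 : ℝ) ^ (q.2 + 1) ≤ (1 / 2) ^ q.2 :=
        pow_le_pow_of_le_one (by norm_num) (by norm_num) (by omega)
      rw [Real.norm_of_nonneg (by positivity)]
      linarith
    · exact absurd h1.1.2.1 h2
    · simp
    · simp

theorem tendsto_sum_Qset_div :
    Tendsto (fun p : ℕ => ∑' a : ℕ, if a ∈ Qset ∧ 2 ^ a ≤ p then (1 : ℝ) / p else 0) atTop
      (nhds 0) := by
  rw [show nhds (0 : ℝ) = nhds (∑' _ : ℕ, (0 : ℝ)) by rw [tsum_zero]]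
  refine tendsto_tsum_of_dominated_convergence summable_geometric_two ?_ ?_
  · intro a
    refine squeeze_zero' (Eventually.of_forall fun p => ?_) (Eventually.of_forall fun p => ?_)
      tendsto_one_div_atTop_nhds_zero_nat
    · split_ifs <;> positivity
    · split_ifs
      · exact le_rfl
      · positivity
  · refine Eventually.of_forall fun p a => ?_
    split_ifs with h
    · rw [Real.norm_of_nonneg (by positivity), one_div_pow]
      apply one_div_le_one_div_of_le (by positivity)
      exact_mod_cast h.2
    · rw [norm_zero]; positivity

theorem tendsto_iotaInv_div (hSH : StandingHyp) :
    Tendsto (fun p : ℕ => (iotaInv 1 p : ℝ) / p) atTop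
      (nhds (∑' q : ↥Rset, (1 / 2 : ℝ) ^ ((q : ℕ × ℕ).2 + 1))) := by
  rw [tsum_Rset]
  have h := (tendsto_one_div_atTop_nhds_zero_nat (𝕜 := ℝ)).add tendsto_sum_Qset_div |>.add
    tendsto_sum_Rset_div
  rw [add_zero, zero_add] at h
  refine h.congr fun p => ?_
  rw [iotaInv_one_eq hSH p]
  push_cast
  rw [add_div, add_div]
  congr 1
  · congr 1
    rw [tsum_eq_sum (s := (Finset.range (p + 1)).filter (fun a => a ∈ Qset ∧ 2 ^ a ≤ p))]
    · rw [Finset.sum_congr rfl fun a ha => if_pos (Finset.mem_filter.mp ha).2]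
      simp [div_eq_mul_inv]
    · intro a ha
      rw [if_neg]
      intro h2
      apply ha
      rw [Finset.mem_filter, Finset.mem_range]
      have : a < 2 ^ a := Nat.lt_two_pow_self
      exact ⟨by omega, h2⟩
  · rw [tsum_eq_sum (s := (Finset.range p ×ˢ Finset.range p).filter
            (fun q => q ∈ Rset ∧ 2 ^ q.2 < p))]
    · rw [Finset.sum_congr rfl fun a ha => if_pos (Finset.mem_filter.mp ha).2, Finset.sum_div]
    · intro q hq
      rw [if_neg]
      intro h2
      apply hq
      rw [Finset.mem_filter, Finset.mem_product, Finset.mem_range, Finset.mem_range]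
      have h3 : q.2 < 2 ^ q.2 := Nat.lt_two_pow_self
      have h4 := h2.1.2.1
      exact ⟨⟨by omega, by omega⟩, h2⟩

theorem iotaInv_iota (hSH : StandingHyp) (t : ℕ) : iotaInv 1 (iota 1 (t + 1)) = t + 1 := by
  apply IsGreatest.csSup_eq
  refine ⟨⟨by omega, le_rfl⟩, ?_⟩
  rintro x ⟨hx1, hx2⟩
  obtain ⟨s, rfl⟩ := Nat.exists_eq_add_of_le' hx1
  have := (range_iota hSH).1.le_iff_le.mp hx2
  omega

theorem tendsto_div_iota (hSH : StandingHyp) :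
    Tendsto (fun x : ℕ => (x : ℝ) / (iota 1 x : ℝ)) atTop
      (nhds (∑' q : ↥Rset, (1 / 2 : ℝ) ^ ((q : ℕ × ℕ).2 + 1))) := by
  rw [← tendsto_add_atTop_iff_nat 1]
  refine ((tendsto_iotaInv_div hSH).comp (range_iota hSH).1.tendsto_atTop).congr fun t => ?_
  simp only [Function.comp_apply, iotaInv_iota hSH]

theorem mem_seg {f : ℕ → List ℕ} {n j x : ℕ} (hj : j < n) (hx : x ∈ f j) : x ∈ seg f n := by
  induction n with
  | zero => omega
  | succ n ih =>
    rw [seg, List.mem_append, List.mem_cons]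
    rcases Nat.lt_succ_iff_lt_or_eq.mp hj with h | rfl
    · exact Or.inl (ih h)
    · exact Or.inr (Or.inr hx)

theorem curl_append_singleton_of_not_mem {Z : List ℕ} {n : ℕ} (h : n ∉ Z) :
    curl (Z ++ [n]) = 1 := by
  apply le_antisymm _ (one_le_curl _)
  by_contra hgt
  have hgt' : 2 ≤ _ := not_le.mp hgt
  rw [le_curl_iff le_rfl] at hgt'
  obtain ⟨X, Y, hY, hX⟩ := hgt'
  obtain ⟨Y', y, rfl⟩ : ∃ Y' y, Y = Y' ++ [y] :=
    ⟨_, _, (List.dropLast_append_getLast hY).symm⟩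
  have hX' : Z ++ [n] = (X ++ Y' ++ [y] ++ Y') ++ [y] := by
    rw [hX]; simp [List.replicate_succ]
  obtain ⟨h1, h2⟩ := List.append_inj' hX' rfl
  simp only [List.cons.injEq, and_true] at h2
  subst h2
  exact h (by rw [h1]; simp)

/-- The first occurrence of `n` in `A^(2)` is the end of some `B_{t+1}^(2)`, so that `n` occurs
in `T_{a+1}^(2)` exactly for `a ≥ t`, and `T_{t+1}^(2)` has curling number `1`. -/
theorem tfun_spec (hSH : StandingHyp) {n : ℕ} (hn : 3 ≤ n)
    (hne : {p : ℕ | 1 ≤ p ∧ gij 2 p = n}.Nonempty) :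
    tfun 2 n - 1 ∈ Qset ∧ (∀ a, a < tfun 2 n - 1 → n ∉ Tstr 2 (a + 1)) ∧
      n ∈ Tstr 2 (tfun 2 n - 1 + 1) := by
  obtain ⟨hp1, hpn⟩ : 1 ≤ phi 2 n ∧ gij 2 (phi 2 n) = n := Nat.sInf_mem hne
  have hmin : ∀ p, 1 ≤ p → gij 2 p = n → phi 2 n ≤ p := fun p h1 h2 => Nat.sInf_le ⟨h1, h2⟩
  unfold tfun
  obtain ⟨p, hp⟩ : ∃ p, phi 2 n = p + 1 := Nat.exists_eq_add_of_le' hp1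
  rw [hp] at hpn hmin ⊢
  have hnew : ∀ q ≤ p, n ∉ gPrefix 2 q := by
    intro q hq
    induction q with
    | zero => simp [gPrefix]
    | succ q ih =>
      rw [gPrefix, List.mem_append, List.mem_singleton]
      rintro (h | h)
      · exact ih (by omega) h
      · have := hmin (q + 1) (by omega) h.symm
        omega
  have hlast : gPrefix 2 (p + 1) = gPrefix 2 p ++ [n] := by
    rw [gPrefix, ← hpn]
    rfl
  have hex : ∃ i, p < (ruler (i + 1)).length := ⟨p, ruler_strictMono_length.id_le (p + 1)⟩
  obtain ⟨i, hi1, hi2⟩ : ∃ i, (ruler i).length ≤ p ∧ p < (ruler (i + 1)).length := by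
    refine ⟨Nat.find hex, ?_, Nat.find_spec hex⟩
    rcases Nat.eq_zero_or_pos (Nat.find hex) with h0 | h0
    · rw [h0]; simp [ruler, seg]
    · obtain ⟨j, hj⟩ : ∃ j, Nat.find hex = j + 1 := Nat.exists_eq_add_of_le' h0
      rw [hj]
      exact not_lt.mp (Nat.find_min hex (m := j) (by omega))
  obtain ⟨v, hv⟩ : ∃ v, padicValNat 3 (i + 1) = v := ⟨_, rfl⟩
  obtain ⟨l, hl⟩ := Nat.exists_eq_add_of_le hi1
  have hlen : (ruler (i + 1)).length = (ruler i).length + 1 + (Tstr 2 (v + 1)).length := by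
    rw [← hv]
    change (ruler i ++ 2 :: Tstr 2 (padicValNat 3 (i + 1) + 1)).length = _
    simp
    omega
  have hlU : l ≤ (Tstr 2 (v + 1)).length := by omega
  have heq := ruler_append_eq_gPrefix hSH i l (ruler_eq_gPrefix hSH i) (by rw [hv]; exact hlU)
  rw [show (ruler i).length + 1 + l = p + 1 by omega, hlast] at heq
  have hnr : n ∉ ruler i := by
    rw [ruler_eq_gPrefix hSH]
    exact hnew _ hi1
  obtain ⟨l, rfl⟩ : ∃ l', l = l' + 1 := by
    rcases Nat.eq_zero_or_pos l with rfl | h0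
    · have := (List.append_inj' heq rfl).2
      simp at this
      omega
    · exact Nat.exists_eq_add_of_le' h0
  have hgl : gPrefix 3 (l + 1) = gPrefix 3 l ++ [max 3 (curl (gPrefix 3 l))] := rfl
  have heq' := heq
  rw [hgl, ← List.cons_append, ← List.append_assoc] at heq'
  obtain ⟨h1, h2⟩ := List.append_inj' heq' rfl
  simp only [List.cons.injEq, and_true] at h2
  rw [h2] at hgl
  have hnl : n ∉ gPrefix 3 l := by
    intro h3
    apply hnew p le_rfl
    rw [← h1]
    simp [h3]
  have hnl1 : n ∈ gPrefix 3 (l + 1) := by rw [hgl]; simp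
  have hnv : n ∈ Tstr 2 (v + 1) := by
    have h3 : (Tstr 2 (v + 1)).length = tau 2 (v + 1) := length_gPrefix _ _
    exact (gPrefix_prefix_of_le 3 (h3 ▸ hlU)).subset hnl1
  have hblock : ∀ a, 3 ^ a < i + 1 → n ∉ Tstr 2 (a + 1) := by
    intro a ha h3
    have hpos : 0 < 3 ^ a := by positivity
    refine hnr (mem_seg (j := 3 ^ a - 1) (by omega) ?_)
    unfold rulerBlock
    rw [Nat.sub_add_cancel hpos, padicValNat.prime_pow]
    exact h3
  have hi3 : i + 1 = 3 ^ v := by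
    have h3 := Nat.le_of_dvd (by omega)
      ((pow_dvd_iff_le_padicValNat (n := i + 1) (by omega) v).mpr hv.ge)
    rcases h3.eq_or_lt with h4 | h4
    · exact h4.symm
    · exact absurd hnv (hblock v h4)
  have hcount : (gPrefix 2 (p + 1)).count 2 = 3 ^ v := by
    rw [hlast, ← heq, List.count_append, count_ruler, List.count_cons_self,
      List.count_eq_zero_of_not_mem, ← hi3]
    intro h3
    have := le_of_mem_gPrefix h3
    omega
  have ht : 1 + Nat.log (2 + 1) ((gPrefix 2 (p + 1)).count 2) - 1 = v := by
    rw [hcount, Nat.log_pow (by norm_num)]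
    omega
  rw [ht]
  have hlow : ∀ a, a < v → n ∉ Tstr 2 (a + 1) := fun a ha =>
    hblock a (by rw [hi3]; exact Nat.pow_lt_pow_right (by norm_num) ha)
  refine ⟨?_, hlow, hnv⟩
  have hinf : {k | curl (gPrefix 3 k) ≤ 2}.Infinite := (hSH 2 (by norm_num)).2
  have hc1 : curl (gPrefix 3 (l + 1)) = 1 := by
    rw [hgl]
    exact curl_append_singleton_of_not_mem hnl
  obtain ⟨u, hu⟩ : ∃ u, Nat.nth (fun k => curl (gPrefix 3 k) ≤ 2) u = l + 1 := by
    have : l + 1 ∈ Set.range (Nat.nth fun k => curl (gPrefix 3 k) ≤ 2) := by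
      rw [Nat.range_nth_of_infinite hinf]
      exact hc1.le.trans one_le_two
    exact this
  have huT : gPrefix 3 (l + 1) = Tstr 2 (u + 1) := by rw [← hu]; rfl
  have huv : u ≤ v := by
    apply (strictMono_length_Tstr hSH).le_iff_le.mp
    have : (Tstr 2 (u + 1)).length = l + 1 := by rw [← huT, length_gPrefix]
    simp only [this]
    exact hlU
  have huv' : u = v := by
    rcases huv.eq_or_lt with h | h
    · exact h
    · exact absurd (huT ▸ hnl1) (hlow u h)
  rw [huT, huv'] at hc1
  exact hc1

theorem Tstr_prefix_of_le (hSH : StandingHyp) {a b : ℕ} (h : a ≤ b) :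
    Tstr 2 (a + 1) <+: Tstr 2 (b + 1) := by
  apply gPrefix_prefix_of_le
  have := (strictMono_length_Tstr hSH).monotone h
  simp only [length_Tstr] at this
  exact this

theorem exists_mem_Rset (hSH : StandingHyp) {t : ℕ} (ht : t ∈ Qset) : ∃ b, (t, b) ∈ Rset := by
  refine ⟨t + 1 + 2 * (Tstr 2 (t + 1)).length, ht, by simp only; omega, ?_⟩
  rintro ⟨s, hs, h⟩
  have h1 := hs.length_le
  have h2 := congrArg List.length h
  have h3 := (strictMono_length_Tstr hSH).id_le (t + 1 + 2 * (Tstr 2 (t + 1)).length)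
  simp only [List.length_append, id] at h1 h2 h3
  omega

theorem hasSum_half_pow_tail (t : ℕ) :
    HasSum (fun b : ℕ => if t ≤ b then (2 : ℝ) ^ t * (1 / 2) ^ (b + 1) else 0) 1 := by
  have hinj : Function.Injective fun c : ℕ => t + c := fun c c' h => by simpa using h
  rw [← hinj.hasSum_iff]
  · have h := hasSum_geometric_two.mul_left (1 / 2 : ℝ)
    norm_num at h
    refine (congrArg (HasSum · _) (funext fun c => ?_)).mpr h
    simp only [Function.comp_apply, Nat.le_add_right, if_true]
    rw [pow_add, pow_add, ← mul_assoc, ← mul_assoc, ← mul_pow]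
    norm_num
    ring
  · intro b hb
    rw [if_neg]
    intro h
    exact hb ⟨b - t, by simp only; omega⟩

theorem hasSum_half_pow_corner (t : ℕ) :
    HasSum (fun q : ℕ × ℕ => if t ≤ q.1 ∧ q.1 < q.2 then (2 : ℝ) ^ t * (1 / 2) ^ (q.2 + 1)
      else 0) 1 := by
  have hinj : Function.Injective fun c : ℕ × ℕ => (t + c.1, t + c.1 + 1 + c.2) := by
    rintro ⟨c, c'⟩ ⟨e, e'⟩ h
    simp only [Prod.mk.injEq] at h ⊢
    omega
  rw [← hinj.hasSum_iff]
  · have h := hasSum_geometric_two.mul_left (1 / 2 : ℝ)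
    norm_num at h
    have hs := h.summable
    have h2 := h.mul h (hs.mul_of_nonneg hs (fun c => by positivity) fun c => by positivity)
    rw [mul_one] at h2
    refine (congrArg (HasSum · _) (funext fun c => ?_)).mpr h2
    have hc : t ≤ t + c.1 ∧ t + c.1 < t + c.1 + 1 + c.2 := by omega
    simp only [Function.comp_apply, hc, and_self, if_true, pow_add]
    have : (2 : ℝ) ^ t * (1 / 2) ^ t = 1 := by rw [← mul_pow]; norm_num
    linear_combination (1 / 4 * (1 / 2 : ℝ) ^ c.1 * (1 / 2) ^ c.2) * this
  · rintro ⟨a, b⟩ hb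
    rw [if_neg]
    rintro ⟨h1, h2⟩
    exact hb ⟨(a - t, b - a - 1), by simp only [Prod.mk.injEq] at *; omega⟩

theorem mem_Rset_of_not_mem {n a b : ℕ} (ha : a ∈ Qset) (hab : a < b)
    (hna : n ∉ Tstr 2 (a + 1)) (hnb : n ∈ Tstr 2 (b + 1)) : (a, b) ∈ Rset := by
  refine ⟨ha, hab, ?_⟩
  rintro ⟨s, hs, h⟩
  simp only at hs h
  rw [← h, List.mem_append] at hnb
  rcases hnb with h1 | h1
  · exact hna h1
  · exact hna (hs.subset h1)

theorem hasSum_prod_finset (s : Finset ℕ) {f : ℕ → ℝ} {c : ℝ} (hf : HasSum f c) :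
    HasSum (fun q : ℕ × ℕ => if q.1 ∈ s then f q.2 else 0) (s.card * c) := by
  have hinj : ∀ a : ℕ, Function.Injective fun b : ℕ => (a, b) := fun a b b' h => by simpa using h
  have h1 : ∀ a ∈ s, HasSum (fun q : ℕ × ℕ => if q.1 = a then f q.2 else 0) c := by
    intro a _
    rw [← (hinj a).hasSum_iff]
    · refine (congrArg (HasSum · _) (funext fun b => ?_)).mpr hf
      simp
    · rintro ⟨a', b⟩ hb
      rw [if_neg]
      rintro rfl
      exact hb ⟨b, rfl⟩
  have h2 := hasSum_sum h1
  rw [Finset.sum_const, nsmul_eq_mul] at h2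
  refine (congrArg (HasSum · _) (funext fun q => ?_)).mpr h2
  rw [Finset.sum_ite_eq]

/-- If `t` indexes the first `T_{t+1}^(2)` containing `n`, the pairs `(a, b)` of `R` with `b < t`,
with `a < t ≤ b`, and with `t ≤ a` contribute to `ν * 2 ^ t` respectively an integer, the number
of elements of `Q` below `t`, and a real in `(0, 1]`. -/
theorem iotaInv_two_pow_eq_ceil (hSH : StandingHyp) {n t : ℕ} (htQ : t ∈ Qset)
    (hlow : ∀ a, a < t → n ∉ Tstr 2 (a + 1)) (hnt : n ∈ Tstr 2 (t + 1)) :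
    (iotaInv 1 (2 ^ t) : ℤ) - 1 =
      ⌈(∑' q : ↥Rset, (1 / 2 : ℝ) ^ ((q : ℕ × ℕ).2 + 1)) * (2 : ℝ) ^ t⌉ := by
  obtain ⟨g, hg⟩ : ∃ g : ℕ × ℕ → ℝ, g = fun q => (2 : ℝ) ^ t * (1 / 2) ^ (q.2 + 1) := ⟨_, rfl⟩
  have hg0 : ∀ q, 0 < g q := fun q => by rw [hg]; positivity
  obtain ⟨FR, hFR⟩ : ∃ FR, FR = (Finset.range (2 ^ t) ×ˢ Finset.range (2 ^ t)).filter
      (fun q => q ∈ Rset ∧ 2 ^ q.2 < 2 ^ t) := ⟨_, rfl⟩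
  have hmemFR : ∀ q, q ∈ FR ↔ q ∈ Rset ∧ q.2 < t := by
    intro q
    rw [hFR, Finset.mem_filter, Finset.mem_product, Finset.mem_range, Finset.mem_range,
      Nat.pow_lt_pow_iff_right (by norm_num)]
    constructor
    · exact And.right
    · intro h
      have h1 := h.1.2.1
      have h2 : t < 2 ^ t := Nat.lt_two_pow_self
      exact ⟨⟨by omega, by omega⟩, h⟩
  obtain ⟨FQ, hFQ⟩ : ∃ FQ, FQ = (Finset.range t).filter (fun a => a ∈ Qset) := ⟨_, rfl⟩
  have hmemFQ : ∀ a, a ∈ FQ ↔ a < t ∧ a ∈ Qset := fun a => by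
    rw [hFQ, Finset.mem_filter, Finset.mem_range]
  have hcardQ : ((Finset.range (2 ^ t + 1)).filter
      (fun a => a ∈ Qset ∧ 2 ^ a ≤ 2 ^ t)).card = FQ.card + 1 := by
    rw [← Finset.card_insert_of_notMem (a := t) (s := FQ) (by simp [hmemFQ])]
    congr 1
    ext a
    rw [Finset.mem_filter, Finset.mem_range, Finset.mem_insert, hmemFQ,
      Nat.pow_le_pow_iff_right (by norm_num)]
    have h2 : t < 2 ^ t := Nat.lt_two_pow_self
    constructor
    · rintro ⟨-, h3, h4⟩
      rcases h4.eq_or_lt with h5 | h5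
      · exact Or.inl h5
      · exact Or.inr ⟨h5, h3⟩
    · rintro (rfl | ⟨h3, h4⟩)
      · exact ⟨by omega, htQ, le_rfl⟩
      · exact ⟨by omega, h4, h3.le⟩
  have hterm : ∀ q ∈ FR, (((2 ^ t + 2 ^ q.2 - 2 ^ q.1) / 2 ^ (q.2 + 1) : ℕ) : ℝ) = g q := by
    intro q hq
    obtain ⟨hqR, hqt⟩ := (hmemFR q).mp hq
    obtain ⟨d, rfl⟩ := Nat.exists_eq_add_of_lt hqt
    have h1 : 2 ^ q.1 < 2 ^ q.2 := Nat.pow_lt_pow_right (by norm_num) hqR.2.1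
    have h2 : 2 ^ (q.2 + d + 1) = 2 ^ d * 2 ^ (q.2 + 1) := by ring
    have h3 : (2 ^ (q.2 + d + 1) + 2 ^ q.2 - 2 ^ q.1) / 2 ^ (q.2 + 1) = 2 ^ d := by
      have h4 : 2 ^ (q.2 + 1) = 2 * 2 ^ q.2 := pow_succ' _ _
      have h5 : 0 < 2 ^ q.1 := by positivity
      rw [h2, Nat.add_sub_assoc h1.le, mul_comm, Nat.mul_add_div (by positivity),
        Nat.div_eq_of_lt (by omega), add_zero]
    rw [h3, hg]
    push_cast
    rw [one_div_pow]
    field_simp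
    ring
  obtain ⟨k₀, hk₀⟩ : ∃ k₀, k₀ = ∑ q ∈ FR, (2 ^ t + 2 ^ q.2 - 2 ^ q.1) / 2 ^ (q.2 + 1) := ⟨_, rfl⟩
  have hleft := iotaInv_one_eq hSH (2 ^ t)
  rw [hcardQ, ← hFR, ← hk₀] at hleft
  have hsum₀ : HasSum (fun q => if q ∈ FR then g q else 0) (k₀ : ℝ) := by
    have h1 := hasSum_sum_of_ne_finset_zero (f := fun q => if q ∈ FR then g q else 0) (s := FR)
      (L := SummationFilter.unconditional _) fun q hq => if_neg hq
    convert h1 using 1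
    rw [hk₀, Nat.cast_sum]
    exact Finset.sum_congr rfl fun q hq => by rw [if_pos hq, hterm q hq]
  have hsum₁ := hasSum_prod_finset FQ (hasSum_half_pow_tail t)
  rw [mul_one] at hsum₁
  have hcorner := hasSum_half_pow_corner t
  obtain ⟨h₂, hh₂⟩ : ∃ h₂ : ℕ × ℕ → ℝ, h₂ = fun q => if q ∈ Rset ∧ t ≤ q.1 then g q else 0 :=
    ⟨_, rfl⟩
  have hh₂0 : ∀ q, 0 ≤ h₂ q := by
    intro q
    rw [hh₂]
    simp only
    split_ifs
    · exact (hg0 q).le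
    · exact le_rfl
  have hh₂le : ∀ q, h₂ q ≤ if t ≤ q.1 ∧ q.1 < q.2 then (2 : ℝ) ^ t * (1 / 2) ^ (q.2 + 1)
      else 0 := by
    intro q
    rw [hh₂]
    simp only
    split_ifs with h3 h4 h4
    · rw [hg]
    · exact absurd ⟨h3.2, h3.1.2.1⟩ h4
    · positivity
    · exact le_rfl
  have hsum₂ : HasSum h₂ (∑' q, h₂ q) :=
    (Summable.of_nonneg_of_le hh₂0 hh₂le hcorner.summable).hasSum
  have hle1 : ∑' q, h₂ q ≤ 1 := hasSum_le hh₂le hsum₂ hcorner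
  have hpos : 0 < ∑' q, h₂ q := by
    obtain ⟨b, hb⟩ := exists_mem_Rset hSH htQ
    refine hsum₂.summable.tsum_pos hh₂0 (t, b) ?_
    rw [hh₂]
    simp only [hb, le_refl, and_self, if_true]
    exact hg0 _
  have htotal : (∑' q : ↥Rset, (1 / 2 : ℝ) ^ ((q : ℕ × ℕ).2 + 1)) * (2 : ℝ) ^ t =
      k₀ + FQ.card + ∑' q, h₂ q := by
    rw [tsum_Rset, ← tsum_mul_right, ← ((hsum₀.add hsum₁).add hsum₂).tsum_eq]
    refine tsum_congr fun q => ?_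
    obtain ⟨a, b⟩ := q
    simp only [hmemFR, hmemFQ, hh₂, hg]
    by_cases hR : (a, b) ∈ Rset
    · have hab : a < b := hR.2.1
      have haQ : a ∈ Qset := hR.1
      simp only [hR, haQ, true_and, and_true, if_true]
      rcases lt_or_ge b t with h1 | h1
      · simp [h1, hab.trans h1, not_le.mpr h1, not_le.mpr (hab.trans h1), mul_comm]
      · rcases lt_or_ge a t with h3 | h3
        · simp [h1, h3, not_lt.mpr h1, not_le.mpr h3, mul_comm]
        · simp [not_lt.mpr h1, h3, not_lt.mpr h3, mul_comm]
    · have : ¬((a < t ∧ a ∈ Qset) ∧ t ≤ b) := fun h => hR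
        (mem_Rset_of_not_mem h.1.2 (h.1.1.trans_le h.2) (hlow a h.1.1)
          ((Tstr_prefix_of_le hSH h.2).subset hnt))
      simp only [hR, false_and, if_false, zero_mul, zero_add, add_zero, ← ite_and]
      rw [if_neg this]
  rw [hleft, htotal, eq_comm, Int.ceil_eq_iff]
  push_cast
  constructor <;> linarith

/-- Propositions `nu1 propo` and `iota1 round`. (1) For all `p ≥ 0`,
`ι_1⁻¹(p) = 1 + #{a ∈ Q : 2^a ≤ p} + Σ_{(a,b) ∈ R, 2^b < p} ⌊(p+2^b−2^a)/2^{b+1}⌋`.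
(2) `ν_1 := lim x/ι_1(x)` exists and equals `Σ_{(a,b) ∈ R} 2^{−(b+1)}`.
(3) For `n ≥ 4` and `t := t^(2)(n) − 1`, `ι_1⁻¹(2^t) − 1 = ⌈ν_1·2^t⌉`. -/
theorem statement10 (hSH : StandingHyp) :
    (∀ p : ℕ, iotaInv 1 p =
      1 + ((Finset.range (p + 1)).filter (fun a => a ∈ Qset ∧ 2 ^ a ≤ p)).card +
        ∑ q ∈ (Finset.range p ×ˢ Finset.range p).filter
            (fun q => q ∈ Rset ∧ 2 ^ q.2 < p),
          (p + 2 ^ q.2 - 2 ^ q.1) / 2 ^ (q.2 + 1)) ∧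
    ∃ ν : ℝ,
      Tendsto (fun x : ℕ => (x : ℝ) / (iota 1 x : ℝ)) atTop (nhds ν) ∧
      ν = ∑' q : ↥Rset, (1 / 2 : ℝ) ^ ((q : ℕ × ℕ).2 + 1) ∧
      (∀ n : ℕ, 4 ≤ n → {p : ℕ | 1 ≤ p ∧ gij 2 p = n}.Nonempty →
        (iotaInv 1 (2 ^ (tfun 2 n - 1)) : ℤ) - 1 =
          ⌈ν * (2 : ℝ) ^ (tfun 2 n - 1)⌉) := by
  refine ⟨iotaInv_one_eq hSH, _, tendsto_div_iota hSH, rfl, fun n hn hne => ?_⟩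
  obtain ⟨h1, h2, h3⟩ := tfun_spec hSH (by omega) hne
  exact iotaInv_two_pow_eq_ceil hSH h1 h2 h3
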